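/- arXiv:1911.06778 — 2 statements merged into one kernel-verified Lean document; each statement's English description precedes it below -/
import Mathlib

section
/- Under condition [A], if κ_n → ∞ as n → ∞, then for all sufficiently large n ∈ ℕ, P(τ_{ν(n)+1} ≥ κ_n) ≤ e^{−(ρ/4) κ_n}, where ρ := (1/v) ln(1/(1 − (1−δ1)^{v−1} δ2)). -/
noncomputable section

/-- A chain with unbounded variable length memory over the binary alphabet `{0,1}`,
with memory parameter `v ≥ 1`.  For `k ∈ ℕ ∪ {0}` (the distance from the current
position to the nearest `1`) and a word `w` of `v - 1` letters (the letters standing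
to the left of that `1`), `p k w` is the probability of appending the character `1`.
The structure records the sample space, the appended characters `X n = r_n(n)`,
the full configuration `cfg`, the position `mpos ω n` of the rightmost `1` among the
coordinates `≤ n`, and the Markov transition rule `htrans`. -/
structure VLMC (v : ℕ) (p : ℕ → (Fin (v - 1) → Bool) → ℝ) where
  /-- the sample space -/
  Ω : Type
  [mΩ : MeasurableSpace Ω]
  /-- the underlying probability measure -/
  P : MeasureTheory.Measure Ω
  hprob : MeasureTheory.IsProbabilityMeasure P
  hv : 0 < v
  /-- the (fixed) initial configuration; only the coordinates `i ≤ 0` are relevant -/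
  r0 : ℤ → Bool
  /-- `X n` is the random character appended at step `n`, for `n ≥ 1` -/
  X : ℕ → Ω → Bool
  hXmeas : ∀ n, Measurable (X n)
  /-- the full configuration (it does not change in time: at time `n` only the
  coordinates `≤ n` are relevant) -/
  cfg : Ω → ℤ → Bool
  hcfg : ∀ ω i, cfg ω i = if i ≤ 0 then r0 i else X i.toNat ω
  /-- `mpos ω n` is the position of the rightmost `1` among the coordinates `≤ n` -/
  mpos : Ω → ℕ → ℤ
  hmpos : ∀ ω n, mpos ω n ≤ (n : ℤ) ∧ cfg ω (mpos ω n) = true ∧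
    ∀ i : ℤ, mpos ω n < i → i ≤ (n : ℤ) → cfg ω i = false
  /-- the transition rule: on any cylinder (in the appended characters) on which the
  distance from `n` to the nearest `1` equals `k` and the word of the `v - 1` letters
  standing to the left of that `1` equals `w`, the conditional probability that the
  character appended at step `n + 1` equals `1` is `p k w`. -/
  htrans : ∀ (n : ℕ) (b : Fin n → Bool) (k : ℕ) (w : Fin (v - 1) → Bool),
    (∀ ω, (∀ i : Fin n, X (i.1 + 1) ω = b i) →
      ((n : ℤ) - mpos ω n = (k : ℤ) ∧
        ∀ j : Fin (v - 1), cfg ω (mpos ω n - ((v : ℤ) - 1) + (j.1 : ℤ)) = w j)) →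
    P {ω | (∀ i : Fin n, X (i.1 + 1) ω = b i) ∧ X (n + 1) ω = true}
      = ENNReal.ofReal (p k w) * P {ω | ∀ i : Fin n, X (i.1 + 1) ω = b i}

open MeasureTheory Filter

namespace VLMC

variable {v : ℕ} {p : ℕ → (Fin (v - 1) → Bool) → ℝ}

/-- Condition [A]: the initial configuration contains at least one `1`, and all the
transition probabilities lie between `δ2` and `δ1`, where `0 < δ2 < δ1 < 1`. -/
def CondA (S : VLMC v p) (δ1 δ2 : ℝ) : Prop :=
  (∃ i : ℤ, i ≤ 0 ∧ S.r0 i = true) ∧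
  0 < δ2 ∧ δ2 < δ1 ∧ δ1 < 1 ∧
  ∀ (k : ℕ) (w : Fin (v - 1) → Bool), δ2 ≤ p k w ∧ p k w ≤ δ1

/-- `R n`, the number of `1`s appended during the first `n` steps -/
def R (S : VLMC v p) (n : ℕ) (ω : S.Ω) : ℕ :=
  ∑ k ∈ Finset.Icc 1 n, (S.X k ω).toNat

/-- `Y(n) = y₀ = (0,(0,…,0,1))`, i.e. the character at position `n` is `1` and the
`v - 1` letters to its left are all `0` -/
def hitY0 (S : VLMC v p) (ω : S.Ω) (n : ℕ) : Prop :=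
  S.mpos ω n = (n : ℤ) ∧
    ∀ j : Fin (v - 1), S.cfg ω ((n : ℤ) - ((v : ℤ) - 1) + (j.1 : ℤ)) = false

/-- `T k`, the time of the `k`-th visit of the chain `Y` to the state `y₀`
(`T 0 = 0`) -/
def T (S : VLMC v p) : ℕ → S.Ω → ℕ
  | 0, _ => 0
  | k + 1, ω => sInf {n | T S k ω < n ∧ S.hitY0 ω n}

/-- `τ_k = T_k - T_{k-1}`, the spacings between consecutive visits to `y₀` -/
def tau (S : VLMC v p) (k : ℕ) (ω : S.Ω) : ℕ := S.T k ω - S.T (k - 1) ω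

/-- `ζ_k`, the number of `1`s appended at the times `n ∈ (T_{k-1}, T_k]` -/
def zeta (S : VLMC v p) (k : ℕ) (ω : S.Ω) : ℕ :=
  ∑ n ∈ Finset.Ioc (S.T (k - 1) ω) (S.T k ω), (S.X n ω).toNat

/-- `ν(n) = max {k ≥ 0 : T_k < n}` -/
def nu (S : VLMC v p) (n : ℕ) (ω : S.Ω) : ℕ := sSup {k | S.T k ω < n}

/-- the generalized renewal process `Z(n) = Σ_{k=0}^{ν(n)} ζ_k` (with `ζ_0 = 0`) -/
def Z (S : VLMC v p) (n : ℕ) (ω : S.Ω) : ℕ :=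
  ∑ k ∈ Finset.range (S.nu n ω + 1), S.zeta k ω

/-- `a = E ζ / E τ`, where `(τ, ζ) = (τ_2, ζ_2)` has the common distribution of the
regeneration vectors `ξ_k = (τ_k, ζ_k)`, `k ≥ 2` -/
def a (S : VLMC v p) : ℝ :=
  (∫ ω, (S.zeta 2 ω : ℝ) ∂S.P) / (∫ ω, (S.tau 2 ω : ℝ) ∂S.P)

/-- `σ² = E (ζ - aτ)² / E τ` -/
def sigma2 (S : VLMC v p) : ℝ :=
  (∫ ω, ((S.zeta 2 ω : ℝ) - S.a * (S.tau 2 ω : ℝ)) ^ 2 ∂S.P) /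
    (∫ ω, (S.tau 2 ω : ℝ) ∂S.P)

/-- `ψ(λ,μ) = E e^{λτ + μζ}` (as an extended nonnegative real number) -/
def psi (S : VLMC v p) (l m : ℝ) : ENNReal :=
  ∫⁻ ω, ENNReal.ofReal (Real.exp (l * S.tau 2 ω + m * S.zeta 2 ω)) ∂S.P

/-- `ψ₁(λ,μ) = E e^{λτ₁ + μζ₁}` -/
def psi1 (S : VLMC v p) (l m : ℝ) : ℝ :=
  ∫ ω, Real.exp (l * S.tau 1 ω + m * S.zeta 1 ω) ∂S.P

/-- the deviation function `D(θ,α) = sup {λθ + μα : A(λ,μ) ≤ 0}` where `A = ln ψ`,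
so that `A(λ,μ) ≤ 0 ↔ ψ(λ,μ) ≤ 1` -/
def D2 (S : VLMC v p) (θ α : ℝ) : ℝ :=
  sSup {x | ∃ l m : ℝ, S.psi l m ≤ 1 ∧ x = l * θ + m * α}

/-- `D(α) = D(1,α)` -/
def D (S : VLMC v p) (α : ℝ) : ℝ := S.D2 1 α

/-- the chain starts from the state `y₀ = (0,(0,…,0,1))`, i.e. `Y(0) = y₀`: the
initial configuration has a `1` at position `0` preceded by `v - 1` zeros -/
def StartsAtY0 (S : VLMC v p) : Prop :=
  S.r0 0 = true ∧ ∀ i : ℤ, 1 - (v : ℤ) ≤ i → i < 0 → S.r0 i = false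

end VLMC

namespace VLMC

attribute [local instance] VLMC.mΩ VLMC.hprob

variable {v : ℕ} {p : ℕ → (Fin (v - 1) → Bool) → ℝ}

/-- The first `m` appended characters. -/
def history (S : VLMC v p) (m : ℕ) (ω : S.Ω) : Fin m → Bool := fun i => S.X (i.1 + 1) ω

/-- An event that depends only on the first `m` appended characters. -/
def DeterminedBy (S : VLMC v p) (m : ℕ) (E : Set S.Ω) : Prop :=
  ∀ ω ω', S.history m ω = S.history m ω' → ω ∈ E → ω' ∈ E

/-- The event that the characters appended at the steps `m + 1, …, m + j` are all `0`. -/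
def zerosAfter (S : VLMC v p) (m j : ℕ) : Set S.Ω := {ω | ∀ i < j, S.X (m + i + 1) ω = false}

/-- The event that the word `0…01` of length `v` is appended at the steps `m + 1, …, m + v`. -/
def patternAfter (S : VLMC v p) (m : ℕ) : Set S.Ω :=
  S.zerosAfter m (v - 1) ∩ {ω | S.X (m + (v - 1) + 1) ω = true}

/-- The event that none of the first `J` consecutive blocks of length `v` appended after
time `m` is the word `0…01`. -/
def noPattern (S : VLMC v p) (m J : ℕ) : Set S.Ω := {ω | ∀ i < J, ω ∉ S.patternAfter (m + i * v)}

lemma measurable_history (S : VLMC v p) (m : ℕ) : Measurable (S.history m) :=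
  measurable_pi_lambda _ fun i => S.hXmeas (i.1 + 1)

lemma X_eq_of_history_eq (S : VLMC v p) {m : ℕ} {ω ω' : S.Ω}
    (h : S.history m ω = S.history m ω') {i : ℕ} (hi : i < m) :
    S.X (i + 1) ω = S.X (i + 1) ω' := congrFun h ⟨i, hi⟩

lemma cfg_eq_of_history_eq (S : VLMC v p) {m : ℕ} {ω ω' : S.Ω}
    (h : S.history m ω = S.history m ω') {i : ℤ} (hi : i ≤ m) : S.cfg ω i = S.cfg ω' i := by
  rw [S.hcfg, S.hcfg]
  split_ifs with h0
  · rfl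
  · have := S.X_eq_of_history_eq h (i := i.toNat - 1) (by omega)
    rwa [show i.toNat - 1 + 1 = i.toNat by omega] at this

lemma mpos_le_of_history_eq (S : VLMC v p) {m : ℕ} {ω ω' : S.Ω}
    (h : S.history m ω = S.history m ω') : S.mpos ω m ≤ S.mpos ω' m := by
  by_contra! hlt
  have h1 := (S.hmpos ω' m).2.2 _ hlt (S.hmpos ω m).1
  rw [← S.cfg_eq_of_history_eq h (S.hmpos ω m).1, (S.hmpos ω m).2.1] at h1
  cases h1

lemma mpos_eq_of_history_eq (S : VLMC v p) {m : ℕ} {ω ω' : S.Ω}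
    (h : S.history m ω = S.history m ω') : S.mpos ω m = S.mpos ω' m :=
  le_antisymm (S.mpos_le_of_history_eq h) (S.mpos_le_of_history_eq h.symm)

lemma DeterminedBy.mono {S : VLMC v p} {m m' : ℕ} {E : Set S.Ω} (hE : S.DeterminedBy m E)
    (hm : m ≤ m') : S.DeterminedBy m' E := fun ω ω' h =>
  hE ω ω' (funext fun i => S.X_eq_of_history_eq h (i.2.trans_le hm))

lemma DeterminedBy.inter {S : VLMC v p} {m : ℕ} {E F : Set S.Ω} (hE : S.DeterminedBy m E)
    (hF : S.DeterminedBy m F) : S.DeterminedBy m (E ∩ F) := fun ω ω' h hω =>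
  ⟨hE ω ω' h hω.1, hF ω ω' h hω.2⟩

lemma DeterminedBy.preimage_image {S : VLMC v p} {m : ℕ} {E : Set S.Ω}
    (hE : S.DeterminedBy m E) : S.history m ⁻¹' (S.history m '' E) = E := by
  refine Set.Subset.antisymm ?_ (Set.subset_preimage_image _ _)
  rintro ω ⟨ω', hω', h⟩
  exact hE ω' ω h hω'

lemma DeterminedBy.measurableSet {S : VLMC v p} {m : ℕ} {E : Set S.Ω}
    (hE : S.DeterminedBy m E) : MeasurableSet E := by
  rw [← hE.preimage_image]
  exact S.measurable_history m (Set.toFinite _).measurableSet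

lemma measurableSet_X_eq (S : VLMC v p) (m : ℕ) (c : Bool) :
    MeasurableSet {ω | S.X m ω = c} :=
  S.hXmeas m (measurableSet_singleton c)

lemma exists_measureReal_cylinder_inter (S : VLMC v p) (m : ℕ) (ω₀ : S.Ω) : ∃ k w,
    S.P.real (S.history m ⁻¹' {S.history m ω₀} ∩ {ω | S.X (m + 1) ω = true}) =
      max (p k w) 0 * S.P.real (S.history m ⁻¹' {S.history m ω₀}) := by
  refine ⟨(m - S.mpos ω₀ m).toNat,
    fun j => S.cfg ω₀ (S.mpos ω₀ m - ((v : ℤ) - 1) + (j.1 : ℤ)), ?_⟩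
  have hset : S.history m ⁻¹' {S.history m ω₀} =
      {ω | ∀ i : Fin m, S.X (i.1 + 1) ω = S.history m ω₀ i} := by
    ext ω
    simp [funext_iff, history]
  have key := S.htrans m (S.history m ω₀) (m - S.mpos ω₀ m).toNat
    (fun j => S.cfg ω₀ (S.mpos ω₀ m - ((v : ℤ) - 1) + (j.1 : ℤ))) (by
      intro ω hω
      have h : S.history m ω = S.history m ω₀ := funext hω
      have hle := (S.hmpos ω₀ m).1
      rw [S.mpos_eq_of_history_eq h]
      refine ⟨by omega, fun j => S.cfg_eq_of_history_eq h ?_⟩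
      have := j.2
      omega)
  rw [hset, measureReal_def, measureReal_def]
  change (S.P {ω | (∀ i : Fin m, S.X (i.1 + 1) ω = S.history m ω₀ i) ∧
    S.X (m + 1) ω = true}).toReal = _
  rw [key, ENNReal.toReal_mul, ENNReal.toReal_ofReal']

lemma measureReal_eq_sum_cylinder (S : VLMC v p) {m : ℕ} {E F : Set S.Ω}
    (hE : S.DeterminedBy m E) : S.P.real (E ∩ F) =
      ∑ b ∈ (Set.toFinite (S.history m '' E)).toFinset, S.P.real (S.history m ⁻¹' {b} ∩ F) := by
  have hmeas : ∀ b, MeasurableSet (S.history m ⁻¹' {b}) := fun b =>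
    S.measurable_history m (measurableSet_singleton b)
  have h := sum_measureReal_preimage_singleton (μ := S.P.restrict F)
    (Set.toFinite (S.history m '' E)).toFinset (f := S.history m) (fun b _ => hmeas b)
  rw [Set.Finite.coe_toFinset, hE.preimage_image,
    measureReal_restrict_apply hE.measurableSet] at h
  rw [← h]
  exact Finset.sum_congr rfl fun b _ => measureReal_restrict_apply (hmeas b)

lemma measureReal_inter_one_bounds (S : VLMC v p) {δ1 δ2 : ℝ} (hA : S.CondA δ1 δ2) {m : ℕ}
    {E : Set S.Ω} (hE : S.DeterminedBy m E) :
    δ2 * S.P.real E ≤ S.P.real (E ∩ {ω | S.X (m + 1) ω = true}) ∧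
      S.P.real (E ∩ {ω | S.X (m + 1) ω = true}) ≤ δ1 * S.P.real E := by
  obtain ⟨-, h2, -, -, hp⟩ := hA
  have hsum := S.measureReal_eq_sum_cylinder hE (F := Set.univ)
  simp only [Set.inter_univ] at hsum
  rw [S.measureReal_eq_sum_cylinder hE, hsum, Finset.mul_sum, Finset.mul_sum]
  constructor <;> refine Finset.sum_le_sum fun b hb => ?_ <;>
  · obtain ⟨ω₀, -, rfl⟩ := (Set.Finite.mem_toFinset _).1 hb
    obtain ⟨k, w, h⟩ := S.exists_measureReal_cylinder_inter m ω₀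
    rw [h, max_eq_left (h2.le.trans (hp k w).1)]
    first
    | exact mul_le_mul_of_nonneg_right (hp k w).1 measureReal_nonneg
    | exact mul_le_mul_of_nonneg_right (hp k w).2 measureReal_nonneg

lemma le_measureReal_inter_zero (S : VLMC v p) {δ1 δ2 : ℝ} (hA : S.CondA δ1 δ2) {m : ℕ}
    {E : Set S.Ω} (hE : S.DeterminedBy m E) :
    (1 - δ1) * S.P.real E ≤ S.P.real (E ∩ {ω | S.X (m + 1) ω = false}) := by
  have h := measureReal_inter_add_sdiff (μ := S.P) (s := E) (S.measurableSet_X_eq (m + 1) true)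
  have hdiff : E \ {ω | S.X (m + 1) ω = true} = E ∩ {ω | S.X (m + 1) ω = false} := by
    ext ω
    simp
  rw [hdiff] at h
  have := (S.measureReal_inter_one_bounds hA hE).2
  linarith

lemma determinedBy_zerosAfter (S : VLMC v p) (m j : ℕ) :
    S.DeterminedBy (m + j) (S.zerosAfter m j) := fun ω ω' h hω i hi => by
  rw [← S.X_eq_of_history_eq h (by omega)]
  exact hω i hi

lemma determinedBy_X_eq (S : VLMC v p) (m : ℕ) (c : Bool) :
    S.DeterminedBy (m + 1) {ω | S.X (m + 1) ω = c} := fun ω ω' h hω => by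
  rw [Set.mem_ofPred_eq, ← S.X_eq_of_history_eq h (by omega)]
  exact hω

lemma determinedBy_patternAfter (S : VLMC v p) (m : ℕ) :
    S.DeterminedBy (m + v) (S.patternAfter m) := by
  have hv := S.hv
  exact ((S.determinedBy_zerosAfter m (v - 1)).mono (by omega)).inter
    ((S.determinedBy_X_eq (m + (v - 1)) true).mono (by omega))

lemma determinedBy_noPattern (S : VLMC v p) (m J : ℕ) :
    S.DeterminedBy (m + J * v) (S.noPattern m J) := fun ω ω' h hω i hi hω' => by
  have hle : m + i * v + v ≤ m + J * v := by
    have : (i + 1) * v ≤ J * v := Nat.mul_le_mul_right v hi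
    linarith
  exact hω i hi ((S.determinedBy_patternAfter (m + i * v)).mono hle ω' ω h.symm hω')

lemma le_measureReal_inter_zerosAfter (S : VLMC v p) {δ1 δ2 : ℝ} (hA : S.CondA δ1 δ2) {m : ℕ}
    {E : Set S.Ω} (hE : S.DeterminedBy m E) (j : ℕ) :
    (1 - δ1) ^ j * S.P.real E ≤ S.P.real (E ∩ S.zerosAfter m j) := by
  induction j with
  | zero => simp [zerosAfter]
  | succ j ih =>
    have hset : E ∩ S.zerosAfter m (j + 1) =
        (E ∩ S.zerosAfter m j) ∩ {ω | S.X (m + j + 1) ω = false} := by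
      ext ω
      simp only [zerosAfter, Set.mem_inter_iff, Set.mem_ofPred_eq, Nat.forall_lt_succ_right,
        and_assoc]
    have hstep := S.le_measureReal_inter_zero hA
      ((hE.mono (Nat.le_add_right m j)).inter (S.determinedBy_zerosAfter m j))
    have h1 : 0 ≤ 1 - δ1 := by linarith [hA.2.2.2.1]
    rw [hset]
    calc (1 - δ1) ^ (j + 1) * S.P.real E = (1 - δ1) * ((1 - δ1) ^ j * S.P.real E) := by ring
      _ ≤ (1 - δ1) * S.P.real (E ∩ S.zerosAfter m j) := mul_le_mul_of_nonneg_left ih h1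
      _ ≤ _ := hstep

lemma le_measureReal_inter_patternAfter (S : VLMC v p) {δ1 δ2 : ℝ} (hA : S.CondA δ1 δ2) {m : ℕ}
    {E : Set S.Ω} (hE : S.DeterminedBy m E) :
    (1 - δ1) ^ (v - 1) * δ2 * S.P.real E ≤ S.P.real (E ∩ S.patternAfter m) := by
  have h := (S.measureReal_inter_one_bounds hA
    ((hE.mono (Nat.le_add_right m (v - 1))).inter (S.determinedBy_zerosAfter m (v - 1)))).1
  rw [patternAfter, ← Set.inter_assoc]
  calc (1 - δ1) ^ (v - 1) * δ2 * S.P.real E = δ2 * ((1 - δ1) ^ (v - 1) * S.P.real E) := by ring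
    _ ≤ δ2 * S.P.real (E ∩ S.zerosAfter m (v - 1)) :=
      mul_le_mul_of_nonneg_left (S.le_measureReal_inter_zerosAfter hA hE _) hA.2.1.le
    _ ≤ _ := h

lemma pattern_prob_pos_lt_one (S : VLMC v p) {δ1 δ2 : ℝ} (hA : S.CondA δ1 δ2) :
    0 < (1 - δ1) ^ (v - 1) * δ2 ∧ (1 - δ1) ^ (v - 1) * δ2 < 1 := by
  obtain ⟨-, h2, h21, h1, -⟩ := hA
  have hpow : (1 - δ1) ^ (v - 1) ≤ 1 := pow_le_one₀ (by linarith) (by linarith)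
  have hpos : 0 < (1 - δ1) ^ (v - 1) := pow_pos (by linarith) _
  exact ⟨mul_pos hpos h2, by nlinarith⟩

lemma measureReal_noPattern_le (S : VLMC v p) {δ1 δ2 : ℝ} (hA : S.CondA δ1 δ2) (m J : ℕ) :
    S.P.real (S.noPattern m J) ≤ (1 - (1 - δ1) ^ (v - 1) * δ2) ^ J := by
  induction J with
  | zero => simp
  | succ J ih =>
    have hset : S.noPattern m (J + 1) = S.noPattern m J \ S.patternAfter (m + J * v) := by
      ext ω
      simp only [noPattern, Set.mem_sdiff, Set.mem_ofPred_eq, Nat.forall_lt_succ_right]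
    have hadd := measureReal_inter_add_sdiff (μ := S.P) (s := S.noPattern m J)
      (S.determinedBy_patternAfter (m + J * v)).measurableSet
    have hlow := S.le_measureReal_inter_patternAfter hA (S.determinedBy_noPattern m J)
    have hq := (S.pattern_prob_pos_lt_one hA).2
    rw [hset, pow_succ']
    have := mul_le_mul_of_nonneg_left ih (sub_nonneg.2 hq.le)
    linarith

lemma hitY0_of_mem_patternAfter (S : VLMC v p) {m : ℕ} {ω : S.Ω} (h : ω ∈ S.patternAfter m) :
    S.hitY0 ω (m + v) := by
  have hv := S.hv
  constructor
  · refine le_antisymm (S.hmpos ω (m + v)).1 ?_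
    by_contra! hlt
    have h0 := (S.hmpos ω (m + v)).2.2 _ hlt le_rfl
    have h1 : S.X (m + (v - 1) + 1) ω = true := h.2
    rw [S.hcfg, if_neg (by omega), Int.toNat_natCast,
      show m + v = m + (v - 1) + 1 by omega, h1] at h0
    cases h0
  · intro j
    have hj := j.2
    have h0 := h.1 j.1 j.2
    rw [S.hcfg, if_neg (by omega)]
    convert h0 using 2
    omega

lemma mem_noPattern_of_forall_not_hitY0 (S : VLMC v p) {m H : ℕ} {ω : S.Ω}
    (h : ∀ t, m < t → t < m + H → ¬ S.hitY0 ω t) : ω ∈ S.noPattern m ((H - 1) / v) := by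
  intro i hi hω
  have hv := S.hv
  have h1 : (i + 1) * v ≤ H - 1 :=
    (Nat.mul_le_mul_right v hi).trans (Nat.div_mul_le_self _ _)
  have h2 : (i + 1) * v = i * v + v := by ring
  exact h (m + i * v + v) (by omega) (by omega) (S.hitY0_of_mem_patternAfter hω)

lemma not_hitY0_of_lt_T (S : VLMC v p) {k t : ℕ} {ω : S.Ω} (h1 : S.T k ω < t)
    (h2 : t < S.T (k + 1) ω) : ¬ S.hitY0 ω t := fun h =>
  Nat.notMem_of_lt_sInf (s := {n | S.T k ω < n ∧ S.hitY0 ω n}) h2 ⟨h1, h⟩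

lemma mem_noPattern_of_le_tau (S : VLMC v p) {n H : ℕ} (hn : 0 < n) {ω : S.Ω}
    (h : 2 * H ≤ S.tau (S.nu n ω + 1) ω) :
    ω ∈ S.noPattern 0 ((H - 1) / v) ∪ S.noPattern n ((H - 1) / v) ∪
      S.noPattern (n - H) ((H - 1) / v) := by
  rw [tau, Nat.add_sub_cancel] at h
  by_cases hb : BddAbove {k | S.T k ω < n}
  · have hmem : S.T (S.nu n ω) ω < n := Nat.sSup_mem (s := {k | S.T k ω < n}) ⟨0, hn⟩ hb
    have hnext : n ≤ S.T (S.nu n ω + 1) ω := by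
      by_contra! hlt
      have : S.nu n ω + 1 ≤ S.nu n ω := le_csSup hb hlt
      omega
    by_cases hcase : n + H ≤ S.T (S.nu n ω + 1) ω
    · exact Or.inl <| Or.inr <| S.mem_noPattern_of_forall_not_hitY0 fun t ht1 ht2 =>
        S.not_hitY0_of_lt_T (by omega) (ht2.trans_le hcase)
    · exact Or.inr <| S.mem_noPattern_of_forall_not_hitY0 fun t ht1 ht2 =>
        S.not_hitY0_of_lt_T (k := S.nu n ω) (by omega) (by omega)
  · have hnu : S.nu n ω = 0 := Nat.sSup_of_not_bddAbove hb
    rw [hnu] at h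
    exact Or.inl <| Or.inl <| S.mem_noPattern_of_forall_not_hitY0 fun t ht1 ht2 =>
      S.not_hitY0_of_lt_T (k := 0) ht1 (by omega)

lemma measureReal_le_tau_le (S : VLMC v p) {δ1 δ2 : ℝ} (hA : S.CondA δ1 δ2) {n : ℕ} (hn : 0 < n)
    {x : ℝ} (hx : 0 ≤ x) : S.P.real {ω | x ≤ (S.tau (S.nu n ω + 1) ω : ℝ)} ≤
      3 * (1 - (1 - δ1) ^ (v - 1) * δ2) ^ ((⌊x / 2⌋₊ - 1) / v) := by
  have hsub : {ω | x ≤ (S.tau (S.nu n ω + 1) ω : ℝ)} ⊆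
      S.noPattern 0 ((⌊x / 2⌋₊ - 1) / v) ∪ S.noPattern n ((⌊x / 2⌋₊ - 1) / v) ∪
        S.noPattern (n - ⌊x / 2⌋₊) ((⌊x / 2⌋₊ - 1) / v) := fun ω hω => by
    refine S.mem_noPattern_of_le_tau hn ?_
    have hω : x ≤ (S.tau (S.nu n ω + 1) ω : ℝ) := hω
    have hf := Nat.floor_le (by positivity : 0 ≤ x / 2)
    have : ((2 * ⌊x / 2⌋₊ : ℕ) : ℝ) ≤ (S.tau (S.nu n ω + 1) ω : ℝ) := by
      push_cast
      linarith
    exact_mod_cast this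
  have h0 := S.measureReal_noPattern_le hA 0 ((⌊x / 2⌋₊ - 1) / v)
  have h1 := S.measureReal_noPattern_le hA n ((⌊x / 2⌋₊ - 1) / v)
  have h2 := S.measureReal_noPattern_le hA (n - ⌊x / 2⌋₊) ((⌊x / 2⌋₊ - 1) / v)
  have hu := measureReal_union_le (μ := S.P) (S.noPattern 0 ((⌊x / 2⌋₊ - 1) / v))
    (S.noPattern n ((⌊x / 2⌋₊ - 1) / v))
  have hu' := measureReal_union_le (μ := S.P)
    (S.noPattern 0 ((⌊x / 2⌋₊ - 1) / v) ∪ S.noPattern n ((⌊x / 2⌋₊ - 1) / v))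
    (S.noPattern (n - ⌊x / 2⌋₊) ((⌊x / 2⌋₊ - 1) / v))
  have hm := measureReal_mono (μ := S.P) hsub
  linarith

lemma eventually_three_mul_pow_le_exp {v : ℕ} (hv : 0 < v) {q : ℝ} (hq0 : 0 < q) (hq1 : q < 1) :
    ∀ᶠ x : ℝ in atTop, 3 * (1 - q) ^ ((⌊x / 2⌋₊ - 1) / v) ≤
      Real.exp (-((((1 : ℝ) / v) * Real.log (1 / (1 - q))) / 4) * x) := by
  set L := Real.log (1 / (1 - q)) with hL
  have hLpos : 0 < L := Real.log_pos (by rw [lt_div_iff₀] <;> linarith)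
  have hexp : 1 - q = Real.exp (-L) := by
    rw [hL, one_div, Real.log_inv, neg_neg, Real.exp_log (by linarith)]
  have hv' : (0 : ℝ) < v := by exact_mod_cast hv
  filter_upwards [eventually_ge_atTop ((Real.log 3 * v + 2 * L + L * v) * (4 / L))] with x hx
  have hx' : Real.log 3 * v + 2 * L + L * v ≤ L * x / 4 := by
    have := mul_le_mul_of_nonneg_left hx (by positivity : 0 ≤ L / 4)
    field_simp at this ⊢
    linarith
  have hJ : x / 2 - 2 - v ≤ (((⌊x / 2⌋₊ - 1) / v : ℕ) : ℝ) * v := by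
    have h1 := Nat.lt_floor_add_one (x / 2)
    have h2 : ⌊x / 2⌋₊ ≤ (⌊x / 2⌋₊ - 1) / v * v + v + 1 := by
      have := Nat.div_add_mod' (⌊x / 2⌋₊ - 1) v
      have := Nat.mod_lt (⌊x / 2⌋₊ - 1) hv
      omega
    have h3 : ((⌊x / 2⌋₊ : ℕ) : ℝ) ≤ (((⌊x / 2⌋₊ - 1) / v : ℕ) : ℝ) * v + v + 1 := by
      exact_mod_cast h2
    linarith
  generalize (⌊x / 2⌋₊ - 1) / v = J at hJ
  rw [hexp, ← Real.exp_nat_mul, ← Real.exp_log (by norm_num : (0 : ℝ) < 3), ← Real.exp_add,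
    Real.exp_le_exp]
  have hLJ := mul_le_mul_of_nonneg_left hJ hLpos.le
  have heq : -(1 / (v : ℝ) * L / 4) * x = (-(L * x / 4)) / v := by
    field_simp
  rw [heq, le_div_iff₀ hv']
  linarith

/-- Lemma 4.4: under condition [A], if `κ_n → ∞` then for all
sufficiently large `n`, `P(τ_{ν(n)+1} ≥ κ_n) ≤ e^{-(ρ/4) κ_n}`, where
`ρ = (1/v) ln (1/(1 - (1-δ1)^{v-1} δ2))`. -/
theorem statement9 {v : ℕ} {p : ℕ → (Fin (v - 1) → Bool) → ℝ} (S : VLMC v p)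
    (δ1 δ2 : ℝ) (hA : S.CondA δ1 δ2)
    (κ : ℕ → ℝ) (hκ : Filter.Tendsto κ Filter.atTop Filter.atTop) :
    ∀ᶠ n : ℕ in Filter.atTop,
      S.P {ω | κ n ≤ (S.tau (S.nu n ω + 1) ω : ℝ)} ≤
        ENNReal.ofReal (Real.exp (-((((1 : ℝ) / v) * Real.log (1 / (1 - (1 - δ1) ^ (v - 1) * δ2))) / 4) * κ n)) := by
  obtain ⟨hq0, hq1⟩ := S.pattern_prob_pos_lt_one hA
  filter_upwards [hκ.eventually (eventually_three_mul_pow_le_exp S.hv hq0 hq1),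
    hκ.eventually (eventually_ge_atTop 0), eventually_gt_atTop 0] with n hn hκn hpos
  rw [← ofReal_measureReal]
  exact ENNReal.ofReal_le_ofReal ((S.measureReal_le_tau_le hA hpos hκn).trans hn)

end VLMC
end
end

section
/- Under condition [A], there exist constants Δ > 0, C̃ > 0 and γ̃ > 0 such that for all x ∈ ℕ∪{0} and n ≥ 1 with α := x/n satisfying |α − a| ≤ Δ, one has P(R(n) = x, τ_{ν(n)+1} ≥ ln²n) ≤ C̃ e^{−n D(α) − γ̃ ln²n}. -/
noncomputable section

open MeasureTheory Filter

attribute [instance] VLMC.mΩ VLMC.hprob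

namespace VLMC

/-! ### Histories

A history is read backwards: `h 0` is the most recent letter. -/

/-- The history obtained from `h` by appending the letter `c`. -/
def push (c : Bool) (h : ℕ → Bool) : ℕ → Bool
  | 0 => c
  | i + 1 => h i

@[simp] lemma push_zero (c : Bool) (h : ℕ → Bool) : push c h 0 = c := rfl

@[simp] lemma push_succ (c : Bool) (h : ℕ → Bool) (i : ℕ) : push c h (i + 1) = h i := rfl

/-- The history ends with the word `0…01` of length `v`. -/
def IsHit (v : ℕ) (h : ℕ → Bool) : Prop := h 0 = true ∧ ∀ i < v, 0 < i → h i = false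

instance (v : ℕ) (h : ℕ → Bool) : Decidable (IsHit v h) := by
  unfold IsHit; infer_instance

/-- The distance from the present to the most recent `1`. -/
def lag (h : ℕ → Bool) : ℕ := sInf {i | h i = true}

/-- The probability of appending a `1` to the history `h`. -/
def prob {v : ℕ} (p : ℕ → (Fin (v - 1) → Bool) → ℝ) (h : ℕ → Bool) : ℝ :=
  p (lag h) (fun j => h (lag h + (v - 1) - j.1))

/-- The transition operator of the chain of histories. -/
def step {v : ℕ} (p : ℕ → (Fin (v - 1) → Bool) → ℝ) (F : (ℕ → Bool) → ℝ) (h : ℕ → Bool) : ℝ :=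
  prob p h * F (push true h) + (1 - prob p h) * F (push false h)

/-- The expected value, for the chain started from the history `h`, of the following
functional: a letter `c` after which `k` of the `N` steps remain carries the weight `w k c`, and
the product of the weights is multiplied by `α` if it is stopped at a hit within `N` steps, by
`β` otherwise. -/
def val {v : ℕ} (p : ℕ → (Fin (v - 1) → Bool) → ℝ) (w : ℕ → Bool → ℝ) (α β : ℝ) :
    ℕ → (ℕ → Bool) → ℝ
  | 0, _ => β
  | N + 1, h => step p (fun h' => w N (h' 0) * if IsHit v h' then α else val p w α β N h') h

variable {v : ℕ} {p : ℕ → (Fin (v - 1) → Bool) → ℝ}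

section Histories

lemma lag_le {h : ℕ → Bool} {i : ℕ} (hi : h i = true) : lag h ≤ i := Nat.sInf_le hi

lemma lag_eq {h : ℕ → Bool} {i : ℕ} (hi : h i = true) (hlt : ∀ j < i, h j = false) :
    lag h = i := by
  refine le_antisymm (lag_le hi) ?_
  by_contra! hc
  have h1 : h (lag h) = true := Nat.sInf_mem (s := {i | h i = true}) ⟨i, hi⟩
  rw [hlt _ hc] at h1
  exact Bool.false_ne_true h1

/-- The two histories agree up to `v - 1` letters beyond some `1`. -/
def Agree (v : ℕ) (h h' : ℕ → Bool) : Prop := ∃ i, h i = true ∧ ∀ j < i + v, h j = h' j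

lemma Agree.prob_eq (hv : 0 < v) {h h' : ℕ → Bool} (H : Agree v h h') :
    prob p h = prob p h' := by
  obtain ⟨i, hi, H⟩ := H
  have hl : lag h ≤ i := lag_le hi
  have hm : h (lag h) = true := Nat.sInf_mem (s := {i | h i = true}) ⟨i, hi⟩
  have hl' : lag h' = lag h := by
    refine lag_eq (by rw [← H _ (by omega)]; exact hm) fun j hj => ?_
    rw [← H _ (by omega)]
    have := Nat.notMem_of_lt_sInf hj
    simpa using this
  unfold prob
  rw [hl']
  congr 1
  funext j
  exact H _ (by omega)

lemma Agree.push {h h' : ℕ → Bool} (H : Agree v h h') (c : Bool) :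
    Agree v (push c h) (push c h') := by
  obtain ⟨i, hi, H⟩ := H
  refine ⟨i + 1, hi, fun j hj => ?_⟩
  cases j with
  | zero => rfl
  | succ j => exact H j (by omega)

lemma Agree.isHit_iff {h h' : ℕ → Bool} (hv : 0 < v) (H : Agree v h h') :
    IsHit v h ↔ IsHit v h' := by
  obtain ⟨i, hi, H⟩ := H
  unfold IsHit
  rw [H 0 (by omega)]
  refine and_congr_right fun _ => forall₂_congr fun j hj => ?_
  rw [H j (by omega)]

lemma IsHit.agree {h h' : ℕ → Bool} (H : IsHit v h) (H' : IsHit v h') : Agree v h h' := by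
  refine ⟨0, H.1, fun j hj => ?_⟩
  rcases Nat.eq_zero_or_pos j with rfl | hj0
  · rw [H.1, H'.1]
  · rw [H.2 j (by omega) hj0, H'.2 j (by omega) hj0]

lemma Agree.val_eq (hv : 0 < v) {w : ℕ → Bool → ℝ} {α β : ℝ} (N : ℕ) {h h' : ℕ → Bool}
    (H : Agree v h h') : val p w α β N h = val p w α β N h' := by
  induction N generalizing h h' with
  | zero => rfl
  | succ N ih =>
    simp only [val, step, H.prob_eq hv, push_zero, (H.push _).isHit_iff hv, ih (H.push _)]

lemma step_mono {F G : (ℕ → Bool) → ℝ} (hp : ∀ h, 0 ≤ prob p h ∧ prob p h ≤ 1)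
    (hFG : ∀ h, F h ≤ G h) (h : ℕ → Bool) : step p F h ≤ step p G h :=
  add_le_add (mul_le_mul_of_nonneg_left (hFG _) (hp h).1)
    (mul_le_mul_of_nonneg_left (hFG _) (by linarith [(hp h).2]))

lemma step_const (c : ℝ) (h : ℕ → Bool) : step p (fun _ => c) h = c := by
  unfold step; ring

lemma val_nonneg (hp : ∀ h, 0 ≤ prob p h ∧ prob p h ≤ 1) {w : ℕ → Bool → ℝ} (hw : ∀ k c, 0 ≤ w k c)
    {α β : ℝ} (hα : 0 ≤ α) (hβ : 0 ≤ β) (N : ℕ) (h : ℕ → Bool) : 0 ≤ val p w α β N h := by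
  induction N generalizing h with
  | zero => exact hβ
  | succ N ih =>
    rw [val, ← step_const (p := p) 0 h]
    refine step_mono hp (fun h' => mul_nonneg (hw _ _) ?_) h
    split_ifs
    · exact hα
    · exact ih h'

/-- The probability, for the chain started from `h`, of no hit within `N` steps. -/
abbrev survival (p : ℕ → (Fin (v - 1) → Bool) → ℝ) : ℕ → (ℕ → Bool) → ℝ :=
  val p (fun _ _ => 1) 0 1

lemma survival_succ (N : ℕ) (h : ℕ → Bool) :
    survival p (N + 1) h = step p (fun h' => if IsHit v h' then 0 else survival p N h') h := by
  simp only [survival, val, one_mul]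

lemma survival_le_one (hp : ∀ h, 0 ≤ prob p h ∧ prob p h ≤ 1) (N : ℕ) (h : ℕ → Bool) :
    survival p N h ≤ 1 := by
  induction N generalizing h with
  | zero => exact le_rfl
  | succ N ih =>
    rw [survival_succ]
    refine (step_mono hp (G := fun _ => 1) (fun h' => ?_) h).trans_eq (step_const 1 h)
    split_ifs
    exacts [zero_le_one, ih h']

lemma survival_antitone (hp : ∀ h, 0 ≤ prob p h ∧ prob p h ≤ 1) (h : ℕ → Bool) :
    Antitone fun N => survival p N h := by
  refine antitone_nat_of_succ_le fun N => ?_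
  induction N generalizing h with
  | zero => exact survival_le_one hp 1 h
  | succ N ih =>
    rw [survival_succ, survival_succ N]
    refine step_mono hp (fun h' => ?_) h
    split_ifs
    exacts [le_rfl, ih h']

lemma survival_block {δ1 δ2 : ℝ} (h2 : 0 < δ2) (h1 : δ1 < 1)
    (hp : ∀ h, δ2 ≤ prob p h ∧ prob p h ≤ δ1) {N : ℕ} {c : ℝ} (hc0 : 0 ≤ c)
    (hc : ∀ h, survival p N h ≤ c) (r : ℕ) (hr : r < v) (h : ℕ → Bool)
    (hz : ∀ i < v - 1 - r, h i = false) :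
    survival p (N + (r + 1)) h ≤ (1 - δ2 * (1 - δ1) ^ r) * c := by
  have hp' : ∀ h, 0 ≤ prob p h ∧ prob p h ≤ 1 := fun h =>
    ⟨h2.le.trans (hp h).1, (hp h).2.trans h1.le⟩
  have hc' : ∀ (M : ℕ) (h), (if IsHit v h then 0 else survival p (N + M) h) ≤ c := fun M h => by
    split_ifs
    · exact hc0
    · exact (survival_antitone hp' h (Nat.le_add_right N M)).trans (hc h)
  induction r generalizing h with
  | zero =>
    have hhit : IsHit v (push true h) := by
      refine ⟨rfl, fun i hi hi0 => ?_⟩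
      obtain ⟨i, rfl⟩ := Nat.exists_eq_succ_of_ne_zero hi0.ne'
      exact hz i (by omega)
    rw [zero_add, survival_succ, step, if_pos hhit]
    have hf := hc' 0 (push false h)
    rw [add_zero] at hf
    have := mul_le_mul_of_nonneg_left hf (by linarith [(hp' h).2] : 0 ≤ 1 - prob p h)
    have := mul_le_mul_of_nonneg_right (hp h).1 hc0
    simp only [pow_zero]
    linarith
  | succ r ih =>
    rw [← add_assoc N (r + 1) 1, survival_succ, step]
    have hf : (if IsHit v (push false h) then 0 else survival p (N + (r + 1)) (push false h)) ≤
        (1 - δ2 * (1 - δ1) ^ r) * c := by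
      rw [if_neg (by simp [IsHit])]
      refine ih (by omega) _ fun i hi => ?_
      cases i with
      | zero => rfl
      | succ i => exact hz i (by omega)
    have a1 := mul_le_mul_of_nonneg_left hf (by linarith [(hp' h).2] : 0 ≤ 1 - prob p h)
    have a2 := mul_le_mul_of_nonneg_left (hc' (r + 1) (push true h)) (hp' h).1
    have a3 : 0 ≤ δ2 * (1 - δ1) ^ r * c := by
      have : 0 ≤ 1 - δ1 := by linarith
      positivity
    have a4 := mul_le_mul_of_nonneg_right (hp h).2 a3
    rw [pow_succ]
    nlinarith

/-- The time to the next hit has an exponential tail, uniformly over the starting history. -/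
lemma exists_survival_le {δ1 δ2 : ℝ} (hv : 0 < v) (h2 : 0 < δ2) (h1 : δ1 < 1)
    (hp : ∀ h, δ2 ≤ prob p h ∧ prob p h ≤ δ1) :
    ∃ C > 0, ∃ κ > 0, ∀ N h, survival p N h ≤ C * Real.exp (-4 * κ * N) := by
  have hp' : ∀ h, 0 ≤ prob p h ∧ prob p h ≤ 1 := fun h =>
    ⟨h2.le.trans (hp h).1, (hp h).2.trans h1.le⟩
  have h21 : δ2 ≤ δ1 := (hp fun _ => true).1.trans (hp _).2
  set q := δ2 * (1 - δ1) ^ (v - 1) with hq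
  have hq0 : 0 < q := mul_pos h2 (pow_pos (by linarith) _)
  have hq1 : q < 1 := by
    have : (1 - δ1) ^ (v - 1) ≤ 1 := pow_le_one₀ (by linarith) (by linarith)
    nlinarith
  have hvR : (1 : ℝ) ≤ v := by exact_mod_cast hv
  set ρ := 1 - q / v with hρ
  have hqv : q / v ≤ q := div_le_self hq0.le hvR
  have hρ0 : 0 < ρ := by linarith
  have hρ1 : ρ < 1 := by have := div_pos hq0 (by linarith : (0 : ℝ) < v); linarith
  have hρv : 1 - q ≤ ρ ^ v := by
    have := one_add_mul_le_pow (a := -(q / v)) (by linarith) v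
    rw [← sub_eq_add_neg 1 (q / v)] at this
    refine le_trans (le_of_eq ?_) this
    field_simp
    ring
  have key : ∀ N h, survival p N h ≤ (ρ ^ v)⁻¹ * ρ ^ N := by
    intro N
    induction N using Nat.strong_induction_on with
    | _ N ih =>
      intro h
      rcases lt_or_ge N v with hN | hN
      · refine (survival_le_one hp' N h).trans ?_
        rw [inv_mul_eq_div, one_le_div (pow_pos hρ0 _)]
        exact pow_le_pow_of_le_one hρ0.le hρ1.le hN.le
      · obtain ⟨M, rfl⟩ := Nat.exists_eq_add_of_le' hN
        have hc0 : 0 ≤ (ρ ^ v)⁻¹ * ρ ^ M := by positivity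
        have hb := survival_block h2 h1 hp hc0 (ih M (by omega)) (v - 1) (by omega) h
          (fun i hi => by omega)
        rw [Nat.sub_add_cancel hv] at hb
        refine hb.trans ?_
        rw [pow_add]
        calc (1 - q) * ((ρ ^ v)⁻¹ * ρ ^ M) ≤ ρ ^ v * ((ρ ^ v)⁻¹ * ρ ^ M) :=
              mul_le_mul_of_nonneg_right hρv hc0
          _ = _ := by ring
  refine ⟨(ρ ^ v)⁻¹, by positivity, -Real.log ρ / 4, ?_, fun N h => (key N h).trans_eq ?_⟩
  · have := Real.log_neg hρ0 hρ1
    linarith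
  · congr 1
    rw [show -4 * (-Real.log ρ / 4) * N = N * Real.log ρ by ring, Real.exp_nat_mul,
      Real.exp_log hρ0]

lemma val_le_sum_survival (hp : ∀ h, 0 ≤ prob p h ∧ prob p h ≤ 1) {w : ℕ → Bool → ℝ} {E : ℝ}
    (hw : ∀ k c, 0 ≤ w k c ∧ w k c ≤ E) (N : ℕ) (h : ℕ → Bool) :
    val p w 1 0 N h ≤ ∑ j ∈ Finset.range N, E ^ (j + 1) * survival p j h := by
  have hE : 0 ≤ E := (hw 0 true).1.trans (hw 0 true).2
  induction N generalizing h with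
  | zero => simp [val]
  | succ N ih =>
    have h1 : val p w 1 0 (N + 1) h ≤ step p (fun h' => E * (1 + if IsHit v h' then 0 else
        ∑ j ∈ Finset.range N, E ^ (j + 1) * survival p j h')) h := by
      rw [val]
      refine step_mono hp (fun h' => ?_) h
      refine mul_le_mul (hw _ _).2 ?_ ?_ hE
      · split_ifs
        · simp
        · linarith [ih h']
      · split_ifs
        · exact zero_le_one
        · exact val_nonneg hp (fun k c => (hw k c).1) zero_le_one le_rfl N h'
    refine h1.trans_eq ?_
    rw [Finset.sum_range_succ']
    have h2 : ∀ j, survival p (j + 1) h =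
        step p (fun h' => if IsHit v h' then 0 else survival p j h') h := fun j => survival_succ j h
    simp only [h2]
    have h3 : survival p 0 h = 1 := rfl
    rw [h3]
    simp only [step]
    simp only [mul_add, Finset.sum_add_distrib]
    have h4 : ∀ (a : ℝ) (g : ℕ → Bool), (∑ j ∈ Finset.range N,
        E ^ (j + 1 + 1) * (a * if IsHit v g then 0 else survival p j g)) =
        a * (E * if IsHit v g then 0 else
          ∑ j ∈ Finset.range N, E ^ (j + 1) * survival p j g) := fun a g => by
      split_ifs
      · simp
      · rw [Finset.mul_sum, Finset.mul_sum]
        exact Finset.sum_congr rfl fun j _ => by ring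
    rw [h4, h4]
    ring

end Histories

section Markov

/-- The history of the chain at time `n`. -/
def hist (S : VLMC v p) (n : ℕ) (ω : S.Ω) : ℕ → Bool := fun i => S.cfg ω ((n : ℤ) - i)

/-- The first `n` appended letters. -/
def letters (S : VLMC v p) (n : ℕ) (ω : S.Ω) : Fin n → Bool := fun i => S.X (i.1 + 1) ω

/-- The history determined by the first `n` appended letters. -/
def histOf (S : VLMC v p) (n : ℕ) (b : Fin n → Bool) : ℕ → Bool := fun i =>
  if hi : i < n then b ⟨n - 1 - i, by omega⟩ else S.r0 ((n : ℤ) - i)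

variable (S : VLMC v p)

lemma hist_eq (n : ℕ) (ω : S.Ω) : S.hist n ω = S.histOf n (S.letters n ω) := by
  funext i
  simp only [hist, histOf, letters, S.hcfg]
  by_cases hi : i < n
  · rw [if_neg (by omega), dif_pos hi]
    congr 1
    omega
  · rw [if_pos (by omega), dif_neg hi]

lemma hist_succ (n : ℕ) (ω : S.Ω) : S.hist (n + 1) ω = push (S.X (n + 1) ω) (S.hist n ω) := by
  funext i
  cases i with
  | zero =>
    simp only [hist, push_zero, S.hcfg]
    rw [if_neg (by omega)]
    congr 1
  | succ i =>
    simp only [hist, push_succ]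
    congr 1
    push_cast
    ring

lemma hist_succ_zero (n : ℕ) (ω : S.Ω) : S.hist (n + 1) ω 0 = S.X (n + 1) ω := by
  rw [hist_succ, push_zero]

lemma hist_add (n N i : ℕ) (ω : S.Ω) : S.hist (n + N) ω (i + N) = S.hist n ω i := by
  simp only [hist]
  congr 1
  push_cast
  ring

lemma lag_hist (n : ℕ) (ω : S.Ω) : ((n : ℤ) - S.mpos ω n) = (lag (S.hist n ω) : ℤ) := by
  obtain ⟨h1, h2, h3⟩ := S.hmpos ω n
  have : lag (S.hist n ω) = ((n : ℤ) - S.mpos ω n).toNat := by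
    refine lag_eq ?_ fun j hj => h3 _ (by omega) (by omega)
    simp only [hist]
    rw [show (n : ℤ) - (((n : ℤ) - S.mpos ω n).toNat : ℤ) = S.mpos ω n by omega]
    exact h2
  omega

lemma hitY0_iff (n : ℕ) (ω : S.Ω) : S.hitY0 ω n ↔ IsHit v (S.hist n ω) := by
  have hv := S.hv
  obtain ⟨h1, h2, h3⟩ := S.hmpos ω n
  unfold hitY0 IsHit
  refine and_congr ⟨fun h => ?_, fun h => ?_⟩ ⟨fun h i hi hi0 => ?_, fun h j => ?_⟩
  · rw [h] at h2
    simpa [hist] using h2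
  · by_contra hne
    have := h3 n (lt_of_le_of_ne h1 hne) le_rfl
    simp [hist, this] at h
  · have := h ⟨v - 1 - i, by omega⟩
    simp only [hist]
    rw [← this]
    congr 1
    simp only
    omega
  · have := h (v - 1 - j.1) (by omega) (by omega)
    simp only [hist] at this
    rw [← this]
    congr 1
    omega

lemma measurable_letters (n : ℕ) : Measurable (S.letters n) :=
  measurable_pi_lambda _ fun _ => S.hXmeas _

lemma measurable_comp_hist {β : Type*} [MeasurableSpace β] (n : ℕ) (F : (ℕ → Bool) → β) :
    Measurable fun ω => F (S.hist n ω) := by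
  simp only [hist_eq]
  exact (Measurable.of_discrete (f := fun b => F (S.histOf n b))).comp (S.measurable_letters n)

lemma integrable_comp_hist (n : ℕ) (F : (ℕ → Bool) → ℝ) :
    Integrable (fun ω => F (S.hist n ω)) S.P := by
  simp only [hist_eq]
  exact (integrable_map_measure (f := S.letters n) (g := fun b => F (S.histOf n b))
    Measurable.of_discrete.aestronglyMeasurable
    (S.measurable_letters n).aemeasurable).1 Integrable.of_finite

lemma integral_comp_hist (μ : Measure S.Ω) [IsFiniteMeasure μ] (n : ℕ) (F : (ℕ → Bool) → ℝ) :
    ∫ ω, F (S.hist n ω) ∂μ =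
      ∑ b : Fin n → Bool, μ.real (S.letters n ⁻¹' {b}) * F (S.histOf n b) := by
  simp only [hist_eq]
  have := integral_map (μ := μ) (φ := S.letters n) (f := fun b => F (S.histOf n b))
    (S.measurable_letters n).aemeasurable Measurable.of_discrete.aestronglyMeasurable
  rw [← this, integral_fintype Integrable.of_finite]
  refine Finset.sum_congr rfl fun b _ => ?_
  rw [map_measureReal_apply (S.measurable_letters n) (measurableSet_singleton b), smul_eq_mul]

lemma measurableSet_one (n : ℕ) : MeasurableSet {ω | S.X n ω = true} :=
  S.hXmeas n (measurableSet_singleton true)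

lemma measureReal_letters_one (hp : ∀ h, 0 ≤ prob p h) (n : ℕ) (b : Fin n → Bool) :
    S.P.real (S.letters n ⁻¹' {b} ∩ {ω | S.X (n + 1) ω = true}) =
      S.P.real (S.letters n ⁻¹' {b}) * prob p (S.histOf n b) := by
  have hcyl : S.letters n ⁻¹' {b} = {ω | ∀ i : Fin n, S.X (i.1 + 1) ω = b i} := by
    ext ω
    simp [letters, funext_iff]
  have ht := S.htrans n b (lag (S.histOf n b))
    (fun j => S.histOf n b (lag (S.histOf n b) + (v - 1) - j.1)) (fun ω hω => by
      have hb : S.letters n ω = b := funext hω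
      have hl := S.lag_hist n ω
      have hv := S.hv
      rw [← hb, ← S.hist_eq]
      refine ⟨hl, fun j => ?_⟩
      simp only [hist] at hl ⊢
      congr 1
      omega)
  rw [hcyl]
  have := congrArg ENNReal.toReal ht
  rw [ENNReal.toReal_mul, mul_comm] at this
  exact this.trans (congrArg (_ * ·) (ENNReal.toReal_ofReal (hp (S.histOf n b))))

/-- The Markov property of the chain of histories. -/
lemma integral_hist_succ (hp : ∀ h, 0 ≤ prob p h) (n : ℕ) (F : (ℕ → Bool) → ℝ) :
    ∫ ω, F (S.hist (n + 1) ω) ∂S.P = ∫ ω, step p F (S.hist n ω) ∂S.P := by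
  have one : ∀ G : (ℕ → Bool) → ℝ, ∫ ω in {ω | S.X (n + 1) ω = true}, G (S.hist n ω) ∂S.P =
      ∫ ω, prob p (S.hist n ω) * G (S.hist n ω) ∂S.P := fun G => by
    rw [S.integral_comp_hist S.P n (fun h => prob p h * G h), S.integral_comp_hist]
    refine Finset.sum_congr rfl fun b _ => ?_
    rw [measureReal_restrict_apply ((S.measurable_letters n) (measurableSet_singleton b)),
      S.measureReal_letters_one hp, mul_assoc]
  have hm := S.measurableSet_one (n + 1)
  rw [← integral_add_compl hm (S.integrable_comp_hist _ _)]
  have e1 : ∫ ω in {ω | S.X (n + 1) ω = true}, F (S.hist (n + 1) ω) ∂S.P =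
      ∫ ω in {ω | S.X (n + 1) ω = true}, F (push true (S.hist n ω)) ∂S.P :=
    setIntegral_congr_fun hm fun ω hω => by
      simp only [hist_succ]
      rw [show S.X (n + 1) ω = true from hω]
  have e2 : ∫ ω in {ω | S.X (n + 1) ω = true}ᶜ, F (S.hist (n + 1) ω) ∂S.P =
      ∫ ω in {ω | S.X (n + 1) ω = true}ᶜ, F (push false (S.hist n ω)) ∂S.P :=
    setIntegral_congr_fun hm.compl fun ω hω => by
      simp only [hist_succ]
      rw [show S.X (n + 1) ω = false by simpa using hω]
  have e3 := integral_add_compl hm (S.integrable_comp_hist n fun h => F (push false h))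
  rw [one fun h => F (push false h)] at e3
  rw [e1, e2, one fun h => F (push true h), eq_sub_of_add_eq' e3]
  rw [← integral_sub (S.integrable_comp_hist n fun h => F (push false h))
      (S.integrable_comp_hist n fun h => prob p h * F (push false h)),
    ← integral_add (S.integrable_comp_hist n fun h => prob p h * F (push true h))
      (S.integrable_comp_hist n fun h => F (push false h) - prob p h * F (push false h))]
  refine integral_congr_ae (ae_of_all _ fun ω => ?_)
  simp only [step]
  ring

/-- The functional of the trajectory after time `n` whose expectation is `val`. -/
def pathVal (w : ℕ → Bool → ℝ) (α β : ℝ) : ℕ → ℕ → S.Ω → ℝ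
  | 0, _, _ => β
  | N + 1, n, ω => w N (S.X (n + 1) ω) *
      if IsHit v (S.hist (n + 1) ω) then α else pathVal w α β N (n + 1) ω

lemma exists_pathVal_eq (w : ℕ → Bool → ℝ) (α β : ℝ) (N n : ℕ) :
    ∃ F : (ℕ → Bool) → ℝ, ∀ ω, S.pathVal w α β N n ω = F (S.hist (n + N) ω) := by
  induction N generalizing n with
  | zero => exact ⟨fun _ => β, fun _ => rfl⟩
  | succ N ih =>
    obtain ⟨F, hF⟩ := ih (n + 1)
    refine ⟨fun h => w N (h (0 + N)) * if IsHit v (fun i => h (i + N)) then α else F h,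
      fun ω => ?_⟩
    rw [pathVal, hF, show n + (N + 1) = n + 1 + N by ring]
    simp only [hist_add, hist_succ_zero]

lemma integrable_mul_pathVal (G : (ℕ → Bool) → ℝ) (w : ℕ → Bool → ℝ) (α β : ℝ) (N n : ℕ) :
    Integrable (fun ω => G (S.hist n ω) * S.pathVal w α β N n ω) S.P := by
  obtain ⟨F, hF⟩ := S.exists_pathVal_eq w α β N n
  have := S.integrable_comp_hist (n + N) fun h => G (fun i => h (i + N)) * F h
  simpa only [hF, hist_add] using this

lemma integral_mul_pathVal (hp : ∀ h, 0 ≤ prob p h) (G : (ℕ → Bool) → ℝ) (w : ℕ → Bool → ℝ)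
    (α β : ℝ) (N n : ℕ) :
    ∫ ω, G (S.hist n ω) * S.pathVal w α β N n ω ∂S.P =
      ∫ ω, G (S.hist n ω) * val p w α β N (S.hist n ω) ∂S.P := by
  induction N generalizing n G with
  | zero => rfl
  | succ N ih =>
    let G₁ : (ℕ → Bool) → ℝ := fun h =>
      if IsHit v h then G (fun i => h (i + 1)) * w N (h 0) * α else 0
    let G₂ : (ℕ → Bool) → ℝ := fun h =>
      if IsHit v h then 0 else G (fun i => h (i + 1)) * w N (h 0)
    have e1 : ∀ ω, G (S.hist n ω) * S.pathVal w α β (N + 1) n ω = G₁ (S.hist (n + 1) ω) +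
        G₂ (S.hist (n + 1) ω) * S.pathVal w α β N (n + 1) ω := fun ω => by
      simp only [pathVal, G₁, G₂, hist_add, hist_succ_zero]
      split_ifs <;> ring
    simp only [e1]
    rw [integral_add (S.integrable_comp_hist (n + 1) G₁) (S.integrable_mul_pathVal _ _ _ _ _ _),
      ih, ← integral_add (S.integrable_comp_hist (n + 1) G₁)
        (S.integrable_comp_hist (n + 1) fun h => G₂ h * val p w α β N h),
      S.integral_hist_succ hp n fun h => G₁ h + G₂ h * val p w α β N h]
    refine integral_congr_ae (ae_of_all _ fun ω => ?_)
    simp only [step, val, G₁, G₂, push_succ, push_zero]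
    split_ifs <;> ring

end Markov

section Renewal

variable (S : VLMC v p)

lemma pathVal_nonneg {w : ℕ → Bool → ℝ} (hw : ∀ k c, 0 ≤ w k c) {α β : ℝ} (hα : 0 ≤ α) (hβ : 0 ≤ β)
    (N n : ℕ) (ω : S.Ω) : 0 ≤ S.pathVal w α β N n ω := by
  induction N generalizing n with
  | zero => exact hβ
  | succ N ih =>
    rw [pathVal]
    refine mul_nonneg (hw _ _) ?_
    split_ifs
    exacts [hα, ih _]

lemma pathVal_eq_one {N n : ℕ} {ω : S.Ω} (h : ∀ j, n < j → j ≤ n + N → ¬ S.hitY0 ω j) :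
    S.pathVal (fun _ _ => 1) 0 1 N n ω = 1 := by
  induction N generalizing n with
  | zero => rfl
  | succ N ih =>
    rw [pathVal, if_neg (by rw [← hitY0_iff]; exact h _ (by omega) (by omega)), one_mul]
    exact ih fun j h1 h2 => h j (by omega) (by omega)

/-- The survival probabilities decay exponentially. -/
def SurvivalBound (p : ℕ → (Fin (v - 1) → Bool) → ℝ) (C κ : ℝ) : Prop :=
  0 < C ∧ 0 < κ ∧ ∀ N h, survival p N h ≤ C * Real.exp (-4 * κ * N)

lemma integral_mul_survival_le (hp : ∀ h, 0 ≤ prob p h) {C κ : ℝ} (hs : SurvivalBound p C κ)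
    {G : (ℕ → Bool) → ℝ} (hG : ∀ h, 0 ≤ G h) (N n : ℕ) :
    ∫ ω, G (S.hist n ω) * S.pathVal (fun _ _ => 1) 0 1 N n ω ∂S.P ≤
      C * Real.exp (-4 * κ * N) * ∫ ω, G (S.hist n ω) ∂S.P := by
  rw [S.integral_mul_pathVal hp, ← integral_const_mul]
  refine integral_mono (S.integrable_comp_hist n fun h => G h * survival p N h)
    (S.integrable_comp_hist n fun h => C * Real.exp (-4 * κ * N) * G h) fun ω => ?_
  simp only
  rw [mul_comm]
  exact mul_le_mul_of_nonneg_right (hs.2.2 N _) (hG _)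

/-- Any set on which `f ≥ 0` is at least `1` has measure at most the integral of `f`. -/
lemma measureReal_le_integral {A : Set S.Ω} {f : S.Ω → ℝ} (hf : Integrable f S.P)
    (h0 : ∀ ω, 0 ≤ f ω) (h1 : ∀ ω ∈ A, 1 ≤ f ω) : S.P.real A ≤ ∫ ω, f ω ∂S.P := by
  have := mul_meas_ge_le_integral_of_nonneg (ae_of_all _ h0) hf 1
  rw [one_mul] at this
  exact (measureReal_mono h1).trans this

/-- The trajectory visits `y₀` infinitely often. -/
def Recurrent (ω : S.Ω) : Prop := ∀ m, ∃ n, m < n ∧ S.hitY0 ω n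

lemma ae_recurrent (hp : ∀ h, 0 ≤ prob p h) {C κ : ℝ} (hs : SurvivalBound p C κ) :
    ∀ᵐ ω ∂S.P, S.Recurrent ω := by
  refine ae_all_iff.2 fun m => ?_
  rw [ae_iff, ← measureReal_eq_zero_iff]
  refine le_antisymm ?_ measureReal_nonneg
  have hlim : Tendsto (fun N : ℕ => C * Real.exp (-4 * κ * N)) atTop (nhds 0) := by
    have h1 : Real.exp (-4 * κ) < 1 := by
      rw [Real.exp_lt_one_iff]; linarith [hs.2.1]
    have := (tendsto_pow_atTop_nhds_zero_of_lt_one (Real.exp_pos _).le h1).const_mul C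
    rw [mul_zero] at this
    refine this.congr fun N => ?_
    rw [← Real.exp_nat_mul, mul_comm (N : ℝ)]
  refine ge_of_tendsto' hlim fun N => ?_
  have h1 := S.integral_mul_survival_le hp hs (G := fun _ => 1) (fun _ => zero_le_one) N m
  have h2 := S.integrable_mul_pathVal (fun _ => 1) (fun _ _ => 1) 0 1 N m
  simp only [one_mul, integral_const, smul_eq_mul, mul_one, probReal_univ] at h1 h2
  refine (S.measureReal_le_integral h2
    (S.pathVal_nonneg (fun _ _ => zero_le_one) le_rfl zero_le_one N m) fun ω hω => ?_).trans h1
  refine (S.pathVal_eq_one fun j hj _ hh => ?_).ge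
  exact hω ⟨j, hj, hh⟩

variable {S}

lemma Recurrent.T_succ_mem {ω : S.Ω} (h : S.Recurrent ω) (k : ℕ) :
    S.T k ω < S.T (k + 1) ω ∧ S.hitY0 ω (S.T (k + 1) ω) :=
  Nat.sInf_mem (s := {n | S.T k ω < n ∧ S.hitY0 ω n}) (h _)

lemma not_hit_of_lt_T_succ {ω : S.Ω} {k j : ℕ} (h1 : S.T k ω < j) (h2 : j < S.T (k + 1) ω) :
    ¬ S.hitY0 ω j := fun hh => Nat.notMem_of_lt_sInf h2 ⟨h1, hh⟩

lemma Recurrent.exists_last_hit {ω : S.Ω} (h : S.Recurrent ω) {n : ℕ} (hn : 1 ≤ n) :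
    ∃ i < n, (i = 0 ∨ S.hitY0 ω i) ∧ n ≤ i + S.tau (S.nu n ω + 1) ω ∧
      ∀ j, i < j → j < i + S.tau (S.nu n ω + 1) ω → ¬ S.hitY0 ω j := by
  have hmono : StrictMono fun k => S.T k ω := strictMono_nat_of_lt_succ fun k => (h.T_succ_mem k).1
  have hbdd : BddAbove {k | S.T k ω < n} :=
    ⟨n, fun k hk => (hmono.id_le k).trans (le_of_lt hk)⟩
  have hmem : S.T (S.nu n ω) ω < n :=
    Nat.sSup_mem (s := {k | S.T k ω < n}) ⟨0, show S.T 0 ω < n by rw [T]; omega⟩ hbdd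
  have hnot : n ≤ S.T (S.nu n ω + 1) ω := by
    by_contra! hc
    have : S.nu n ω + 1 ≤ S.nu n ω := le_csSup hbdd hc
    omega
  have hτ : S.T (S.nu n ω) ω + S.tau (S.nu n ω + 1) ω = S.T (S.nu n ω + 1) ω := by
    have := (h.T_succ_mem (S.nu n ω)).1
    simp only [tau, Nat.add_sub_cancel]
    omega
  refine ⟨S.T (S.nu n ω) ω, hmem, ?_, by omega, fun j h1 h2 => not_hit_of_lt_T_succ h1 (by omega)⟩
  rcases hk : S.nu n ω with _ | k
  · left; rfl
  · right; exact (h.T_succ_mem k).2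

variable (S)

lemma measurableSet_hit (n : ℕ) : MeasurableSet {ω | S.hitY0 ω n} := by
  simp only [hitY0_iff]
  exact measurableSet_setOfPred.2 (S.measurable_comp_hist n (IsHit v))

lemma measurable_T (k : ℕ) : Measurable (S.T k) := by
  induction k with
  | zero => exact measurable_const
  | succ k ih =>
    have hm : ∀ n, MeasurableSet {ω | S.T k ω < n ∧ S.hitY0 ω n} := fun n =>
      (measurableSet_lt ih measurable_const).inter (S.measurableSet_hit n)
    refine measurable_of_Iic fun m => ?_
    have : S.T (k + 1) ⁻¹' Set.Iic m = (⋃ n ∈ Set.Iic m, {ω | S.T k ω < n ∧ S.hitY0 ω n}) ∪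
        ⋂ n, {ω | S.T k ω < n ∧ S.hitY0 ω n}ᶜ := by
      ext ω
      simp only [Set.mem_preimage, Set.mem_Iic, Set.mem_union, Set.mem_iUnion, Set.mem_iInter,
        Set.mem_compl_iff, exists_prop, T]
      constructor
      · intro hle
        rcases Set.eq_empty_or_nonempty {n | S.T k ω < n ∧ S.hitY0 ω n} with he | hne
        · right
          intro n hn
          exact (Set.eq_empty_iff_forall_notMem.1 he n) hn
        · left
          exact ⟨_, hle, Nat.sInf_mem hne⟩
      · rintro (⟨n, hn, hmem⟩ | hno)
        · exact (Nat.sInf_le hmem).trans hn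
        · have he : {n | S.T k ω < n ∧ S.hitY0 ω n} = ∅ := Set.eq_empty_iff_forall_notMem.2 hno
          rw [he]
          simp
    rw [this]
    exact (MeasurableSet.biUnion (Set.to_countable _) fun n _ => hm n).union
      (MeasurableSet.iInter fun n => (hm n).compl)

lemma measurable_tau (k : ℕ) : Measurable (S.tau k) :=
  (S.measurable_T k).sub (S.measurable_T (k - 1))

lemma measurable_zeta (k : ℕ) : Measurable (S.zeta k) := by
  have h1 : ∀ ab : ℕ × ℕ, Measurable fun ω => ∑ n ∈ Finset.Ioc ab.1 ab.2, (S.X n ω).toNat :=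
    fun ab => Finset.measurable_sum _ fun n _ =>
      (Measurable.of_discrete (f := Bool.toNat)).comp (S.hXmeas n)
  have h2 : Measurable fun q : (ℕ × ℕ) × S.Ω =>
      ∑ n ∈ Finset.Ioc q.1.1 q.1.2, (S.X n q.2).toNat :=
    measurable_from_prod_countable_right h1
  exact h2.comp (((S.measurable_T (k - 1)).prodMk (S.measurable_T k)).prodMk measurable_id)

lemma zeta_le_tau (k : ℕ) (ω : S.Ω) : S.zeta k ω ≤ S.tau k ω := by
  unfold zeta tau
  refine (Finset.sum_le_card_nsmul _ _ 1 fun n _ => Bool.toNat_le _).trans ?_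
  simp

end Renewal

section MainEstimate

variable (S : VLMC v p)

/-- The number of `1`s among the last `n` letters. -/
def ones (n : ℕ) (h : ℕ → Bool) : ℕ := ∑ j ∈ Finset.range n, (h j).toNat

lemma ones_succ_push (n : ℕ) (c : Bool) (h : ℕ → Bool) :
    ones (n + 1) (push c h) = ones n h + c.toNat := by
  simp [ones, Finset.sum_range_succ']

lemma R_eq_ones (n : ℕ) (ω : S.Ω) : S.R n ω = ones n (S.hist n ω) := by
  induction n with
  | zero => simp [R, ones]
  | succ n ih =>
    rw [hist_succ, ones_succ_push, ← ih, R, R, Finset.sum_Icc_succ_top (by omega)]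

lemma R_bounds (i m : ℕ) (ω : S.Ω) : S.R i ω ≤ S.R (i + m) ω ∧ S.R (i + m) ω ≤ S.R i ω + m := by
  induction m with
  | zero => simp
  | succ m ih =>
    have : S.R (i + (m + 1)) ω = S.R (i + m) ω + (S.X (i + m + 1) ω).toNat := by
      rw [← add_assoc, R, R, Finset.sum_Icc_succ_top (by omega)]
    have := Bool.toNat_le (S.X (i + m + 1) ω)
    omega

/-- The exponential weight of a letter. -/
def wt (l m : ℝ) (c : Bool) : ℝ := Real.exp (l + m * c.toNat)

lemma wt_nonneg (l m : ℝ) (c : Bool) : 0 ≤ wt l m c := (Real.exp_pos _).le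

lemma wt_le {l m κ : ℝ} (hl : |l| ≤ κ) (hm : |m| ≤ κ) (c : Bool) :
    wt l m c ≤ Real.exp (2 * κ) := by
  refine Real.exp_le_exp.2 ?_
  have := abs_le.1 hl
  have := abs_le.1 hm
  cases c <;> simp <;> linarith

lemma sum_exp_le {κ : ℝ} (hκ : 0 < κ) (n : ℕ) :
    ∑ j ∈ Finset.range n, Real.exp (-κ * j) ≤ (1 - Real.exp (-κ))⁻¹ := by
  have h1 : Real.exp (-κ) < 1 := by rw [Real.exp_lt_one_iff]; linarith
  rw [← tsum_geometric_of_lt_one (Real.exp_pos _).le h1]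
  refine le_trans (le_of_eq ?_) ((summable_geometric_of_lt_one (Real.exp_pos _).le h1).sum_le_tsum
    (Finset.range n) fun _ _ => by positivity)
  refine Finset.sum_congr rfl fun j _ => ?_
  rw [← Real.exp_nat_mul, mul_comm]

/-- A uniform bound for the exponential moments of the time to the next hit. -/
def momentBound (C κ : ℝ) : ℝ :=
  max 1 (Real.exp (2 * κ) * C * (1 - Real.exp (-(2 * κ)))⁻¹)

lemma val_wt_le (hp : ∀ h, 0 ≤ prob p h ∧ prob p h ≤ 1) {C κ : ℝ} (hs : SurvivalBound p C κ)
    {l m : ℝ} (hl : |l| ≤ κ) (hm : |m| ≤ κ) (N : ℕ) (h : ℕ → Bool) :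
    val p (fun _ => wt l m) 1 0 N h ≤ momentBound C κ := by
  refine (val_le_sum_survival hp (fun _ c => ⟨wt_nonneg l m c, wt_le hl hm c⟩) N h).trans
    (le_trans ?_ (le_max_right _ _))
  obtain ⟨hC, hκ, hs⟩ := hs
  calc ∑ j ∈ Finset.range N, Real.exp (2 * κ) ^ (j + 1) * survival p j h
      ≤ ∑ j ∈ Finset.range N, Real.exp (2 * κ) * C * Real.exp (-(2 * κ) * j) := by
        refine Finset.sum_le_sum fun j _ => ?_
        refine (mul_le_mul_of_nonneg_left (hs j h) (by positivity)).trans_eq ?_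
        rw [← Real.exp_nat_mul, mul_left_comm, ← Real.exp_add, mul_comm (Real.exp (2 * κ)) C,
          mul_assoc C, ← Real.exp_add]
        congr 2
        push_cast
        ring
    _ ≤ _ := by
        rw [← Finset.mul_sum]
        exact mul_le_mul_of_nonneg_left (sum_exp_le (by linarith) N) (by positivity)

/-- Exponential weights evaluated at the hits have bounded expectation, by a supermartingale
argument. -/
lemma integral_exp_hit_le (hp : ∀ h, 0 ≤ prob p h ∧ prob p h ≤ 1) {C κ : ℝ}
    (hs : SurvivalBound p C κ) {l m : ℝ} (hl : |l| ≤ κ) (hm : |m| ≤ κ)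
    (hφ : ∀ N h, IsHit v h → val p (fun _ => wt l m) 1 0 N h ≤ 1) (i N : ℕ) :
    ∫ ω, Real.exp (l * i + m * ones i (S.hist i ω)) *
      (if IsHit v (S.hist i ω) then 1 else val p (fun _ => wt l m) 1 0 N (S.hist i ω)) ∂S.P ≤
        momentBound C κ := by
  induction i generalizing N with
  | zero =>
    have h1 : ∀ h, Real.exp (l * (0 : ℕ) + m * ones 0 h) *
        (if IsHit v h then 1 else val p (fun _ => wt l m) 1 0 N h) ≤ momentBound C κ := fun h => by
      simp only [ones, Finset.range_zero, Finset.sum_empty, Nat.cast_zero, mul_zero, add_zero,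
        Real.exp_zero, one_mul]
      split_ifs
      · exact le_max_left _ _
      · exact val_wt_le hp hs hl hm N h
    refine (integral_mono (S.integrable_comp_hist 0 fun h => Real.exp (l * (0 : ℕ) + m * ones 0 h) *
        (if IsHit v h then 1 else val p (fun _ => wt l m) 1 0 N h))
      (integrable_const (momentBound C κ)) fun ω => h1 _).trans_eq ?_
    simp
  | succ i ih =>
    refine le_trans ?_ (ih (N + 1))
    rw [S.integral_hist_succ (fun h => (hp h).1) i
      fun h => Real.exp (l * (i + 1 : ℕ) + m * ones (i + 1) h) *
        (if IsHit v h then 1 else val p (fun _ => wt l m) 1 0 N h)]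
    refine integral_mono (S.integrable_comp_hist i _) (S.integrable_comp_hist i
      fun h => Real.exp (l * i + m * ones i h) *
        (if IsHit v h then 1 else val p (fun _ => wt l m) 1 0 (N + 1) h)) fun ω => ?_
    have h2 : ∀ h, step p (fun h => Real.exp (l * (i + 1 : ℕ) + m * ones (i + 1) h) *
        (if IsHit v h then 1 else val p (fun _ => wt l m) 1 0 N h)) h =
        Real.exp (l * i + m * ones i h) * val p (fun _ => wt l m) 1 0 (N + 1) h := fun h => by
      have h3 : ∀ c : Bool, Real.exp (l * (i + 1 : ℕ) + m * (ones i h + c.toNat : ℕ)) =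
          Real.exp (l * i + m * ones i h) * wt l m c := fun c => by
        rw [wt, ← Real.exp_add]
        congr 1
        push_cast
        ring
      simp only [val, step, ones_succ_push, push_zero, h3]
      ring
    simp only [h2]
    refine mul_le_mul_of_nonneg_left ?_ (Real.exp_pos _).le
    split_ifs with hh
    · exact hφ _ _ hh
    · exact le_rfl

/-- The contribution of the trajectories whose last hit before time `n` happens at time `i`. -/
lemma measureReal_last_hit_le (hp : ∀ h, 0 ≤ prob p h ∧ prob p h ≤ 1) {C κ : ℝ}
    (hs : SurvivalBound p C κ) {l m : ℝ} (hl : |l| ≤ κ) (hm : |m| ≤ κ)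
    (hφ : ∀ N h, IsHit v h → val p (fun _ => wt l m) 1 0 N h ≤ 1) {L : ℝ} (x i d : ℕ) (hd : 1 ≤ d) :
    S.P.real {ω | S.R (i + d) ω = x ∧ (i = 0 ∨ S.hitY0 ω i) ∧ ∃ t : ℕ, L ≤ t ∧ d ≤ t ∧
      ∀ j, i < j → j < i + t → ¬ S.hitY0 ω j} ≤
      Real.exp (4 * κ) * C * momentBound C κ * Real.exp (-l * (i + d : ℕ) - m * x - κ * L) *
        Real.exp (-κ * d) := by
  obtain ⟨M, hM⟩ := Nat.exists_eq_add_of_le (hd.trans (le_max_left d ⌈L⌉₊))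
  have hMd : d ≤ M + 1 := by have := le_max_left d ⌈L⌉₊; omega
  have hML : L ≤ M + 1 := by
    refine (Nat.le_ceil L).trans ?_
    have : ⌈L⌉₊ ≤ M + 1 := by have := le_max_right d ⌈L⌉₊; omega
    exact_mod_cast this
  have hκ := hs.2.1
  let G : (ℕ → Bool) → ℝ := fun h => Real.exp (l * i + m * ones i h) *
    if i = 0 ∨ IsHit v h then 1 else 0
  have hG : ∀ h, 0 ≤ G h := fun h => by
    refine mul_nonneg (Real.exp_pos _).le ?_
    split_ifs <;> simp
  have hGint : ∫ ω, G (S.hist i ω) ∂S.P ≤ momentBound C κ := by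
    rcases Nat.eq_zero_or_pos i with rfl | hi
    · simp [G, ones, momentBound]
    · have := S.integral_exp_hit_le hp hs hl hm hφ i 0
      simpa only [G, hi.ne', false_or, val] using this
  set c : ℝ := Real.exp (-l * (i + d : ℕ) - m * x) * Real.exp (2 * κ * d) with hc
  have hc0 : 0 ≤ c := by positivity
  have hintegrable := (S.integrable_mul_pathVal G (fun _ _ => 1) 0 1 M i).const_mul c
  have hpv := S.pathVal_nonneg (w := fun _ _ => 1) (fun _ _ => zero_le_one) le_rfl zero_le_one M i
  refine (S.measureReal_le_integral hintegrable
    (fun ω => mul_nonneg hc0 (mul_nonneg (hG _) (hpv ω))) ?_).trans ?_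
  · rintro ω ⟨hR, hi, t, hLt, hdt, hno⟩
    have hMt : M + 1 ≤ t := by
      have : ⌈L⌉₊ ≤ t := Nat.ceil_le.2 hLt
      have := max_le hdt this
      omega
    rw [S.pathVal_eq_one fun j h1 h2 => hno j h1 (by omega), mul_one]
    rw [hitY0_iff] at hi
    simp only [G, hi, if_true, mul_one, hc]
    rw [← Real.exp_add, ← Real.exp_add, Real.one_le_exp_iff, ← R_eq_ones]
    obtain ⟨b1, b2⟩ := S.R_bounds i d ω
    rw [hR] at b1 b2
    have b1' : (S.R i ω : ℝ) ≤ x := by exact_mod_cast b1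
    have b2' : (x : ℝ) ≤ S.R i ω + d := by exact_mod_cast b2
    have hl' := abs_le.1 hl
    have hm' := abs_le.1 hm
    push_cast
    nlinarith
  · rw [integral_const_mul]
    have h1 := S.integral_mul_survival_le (fun h => (hp h).1) hs hG M i
    have h2 := h1.trans (mul_le_mul_of_nonneg_left hGint
      (mul_nonneg hs.1.le (Real.exp_pos _).le))
    refine (mul_le_mul_of_nonneg_left h2 hc0).trans ?_
    have hK : 0 ≤ C * momentBound C κ :=
      mul_nonneg hs.1.le (zero_le_one.trans (le_max_left _ _))
    have e1 : c * (C * Real.exp (-4 * κ * M) * momentBound C κ) = C * momentBound C κ *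
        Real.exp (-l * (i + d : ℕ) - m * x + 2 * κ * d + -4 * κ * M) := by
      rw [hc, Real.exp_add, Real.exp_add]
      ring
    have e2 : Real.exp (4 * κ) * C * momentBound C κ *
        Real.exp (-l * (i + d : ℕ) - m * x - κ * L) * Real.exp (-κ * d) = C * momentBound C κ *
        Real.exp (4 * κ + (-l * (i + d : ℕ) - m * x - κ * L) + -κ * d) := by
      rw [Real.exp_add, Real.exp_add]
      ring
    rw [e1, e2]
    refine mul_le_mul_of_nonneg_left (Real.exp_le_exp.2 ?_) hK
    have hMd' : (d : ℝ) ≤ M + 1 := by exact_mod_cast hMd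
    nlinarith

/-- The constant in the main estimate. -/
def mainConst (C κ : ℝ) : ℝ :=
  Real.exp (4 * κ) * C * momentBound C κ * (1 - Real.exp (-κ))⁻¹

lemma measureReal_long_cycle_le (hp : ∀ h, 0 ≤ prob p h ∧ prob p h ≤ 1) {C κ : ℝ}
    (hs : SurvivalBound p C κ) {l m : ℝ} (hl : |l| ≤ κ) (hm : |m| ≤ κ)
    (hφ : ∀ N h, IsHit v h → val p (fun _ => wt l m) 1 0 N h ≤ 1) (L : ℝ) (x n : ℕ) (hn : 1 ≤ n) :
    S.P.real {ω | S.R n ω = x ∧ L ≤ (S.tau (S.nu n ω + 1) ω : ℝ)} ≤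
      mainConst C κ * Real.exp (-l * n - m * x - κ * L) := by
  let A : ℕ → Set S.Ω := fun i => {ω | S.R n ω = x ∧ (i = 0 ∨ S.hitY0 ω i) ∧ ∃ t : ℕ, L ≤ t ∧
    n - i ≤ t ∧ ∀ j, i < j → j < i + t → ¬ S.hitY0 ω j}
  have hsub : S.P {ω | S.R n ω = x ∧ L ≤ (S.tau (S.nu n ω + 1) ω : ℝ)} ≤
      S.P (⋃ i ∈ Finset.range n, A i) := by
    refine measure_mono_ae ?_
    filter_upwards [S.ae_recurrent (fun h => (hp h).1) hs] with ω hω hmem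
    obtain ⟨i, hi, h1, h2, h3⟩ := hω.exists_last_hit hn
    exact Set.mem_biUnion (Finset.mem_coe.2 (Finset.mem_range.2 hi))
      ⟨hmem.1, h1, _, hmem.2, by omega, h3⟩
  have hreal := (ENNReal.toReal_mono (measure_ne_top _ _) hsub).trans
    (measureReal_biUnion_finset_le (μ := S.P) (Finset.range n) A)
  refine hreal.trans ?_
  have hA : ∀ i ∈ Finset.range n, S.P.real (A i) ≤ Real.exp (4 * κ) * C * momentBound C κ *
      Real.exp (-l * n - m * x - κ * L) * Real.exp (-κ * (n - 1 - i : ℕ)) := fun i hi => by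
    have hi := Finset.mem_range.1 hi
    have h := S.measureReal_last_hit_le hp hs hl hm hφ (L := L) x i (n - i) (by omega)
    rw [Nat.add_sub_of_le hi.le] at h
    refine h.trans (mul_le_mul_of_nonneg_left (Real.exp_le_exp.2 ?_) ?_)
    · have : ((n - 1 - i : ℕ) : ℝ) ≤ (n - i : ℕ) := by
        exact_mod_cast (by omega : n - 1 - i ≤ n - i)
      nlinarith [hs.2.1]
    · have := hs.1
      have : 0 ≤ momentBound C κ := zero_le_one.trans (le_max_left _ _)
      positivity
  refine (Finset.sum_le_sum hA).trans ?_
  rw [← Finset.mul_sum, Finset.sum_range_reflect (fun j : ℕ => Real.exp (-κ * j)) n, mainConst]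
  have := hs.1
  have : 0 ≤ momentBound C κ := zero_le_one.trans (le_max_left _ _)
  refine (mul_le_mul_of_nonneg_left (sum_exp_le hs.2.1 n) (by positivity)).trans_eq ?_
  ring

end MainEstimate

section Regeneration

variable (S : VLMC v p)

lemma exists_T_one_eq_iff {i : ℕ} (hi : 0 < i) :
    ∃ Q : (ℕ → Bool) → Prop, (∀ h, Q h → IsHit v h) ∧ ∀ ω, S.T 1 ω = i ↔ Q (S.hist i ω) := by
  refine ⟨fun h => IsHit v h ∧ ∀ j, 0 < j → j < i → ¬ IsHit v fun k => h (k + (i - j)),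
    fun h hh => hh.1, fun ω => ?_⟩
  have e : ∀ j, j < i → (fun k => S.hist i ω (k + (i - j))) = S.hist j ω := fun j hj => by
    funext k
    rw [← S.hist_add j (i - j) k ω, Nat.add_sub_of_le hj.le]
  have e' : (∀ j, 0 < j → j < i → ¬ IsHit v fun k => S.hist i ω (k + (i - j))) ↔
      ∀ j, 0 < j → j < i → ¬ S.hitY0 ω j :=
    forall₃_congr fun j _ hj => by rw [e j hj, hitY0_iff]
  simp only [e', ← hitY0_iff]
  constructor
  · intro h
    have hmem := Nat.sInf_mem (s := {n | S.T 0 ω < n ∧ S.hitY0 ω n})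
      (Nat.nonempty_of_pos_sInf (by change 0 < S.T 1 ω; omega))
    refine ⟨h ▸ hmem.2, fun j h0 hj => not_hit_of_lt_T_succ (k := 0) h0 (h ▸ hj)⟩
  · rintro ⟨h1, h2⟩
    refine le_antisymm (Nat.sInf_le ⟨hi, h1⟩) ?_
    by_contra! hc
    have hmem := Nat.sInf_mem (s := {n | S.T 0 ω < n ∧ S.hitY0 ω n}) ⟨i, hi, h1⟩
    exact h2 _ hmem.1 hc hmem.2

/-- The regeneration property at the first visit to `y₀`. -/
lemma lintegral_pathVal_T_one (hp : ∀ h, 0 ≤ prob p h) {C κ : ℝ} (hs : SurvivalBound p C κ)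
    {w : ℕ → Bool → ℝ} (hw : ∀ k c, 0 ≤ w k c) {α β : ℝ} (hα : 0 ≤ α) (hβ : 0 ≤ β) (N : ℕ)
    {y : ℕ → Bool} (hy : IsHit v y) :
    ∫⁻ ω, ENNReal.ofReal (S.pathVal w α β N (S.T 1 ω) ω) ∂S.P =
      ENNReal.ofReal (val p w α β N y) := by
  have hms : ∀ i, MeasurableSet {ω | S.T 1 ω = i} := fun i =>
    S.measurable_T 1 (measurableSet_singleton i)
  have hsplit : ∀ g : S.Ω → ENNReal,
      ∫⁻ ω, g ω ∂S.P = ∑' i, ∫⁻ ω in {ω | S.T 1 ω = i}, g ω ∂S.P := fun g => by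
    rw [← lintegral_iUnion hms]
    · have : ⋃ i, {ω | S.T 1 ω = i} = Set.univ := Set.eq_univ_of_forall fun ω => by simp
      rw [this, setLIntegral_univ]
    · intro i j hij
      refine Set.disjoint_left.2 fun ω h1 h2 => hij ?_
      exact (show S.T 1 ω = i from h1).symm.trans h2
  have hfib : ∀ i, ∫⁻ ω in {ω | S.T 1 ω = i},
      ENNReal.ofReal (S.pathVal w α β N (S.T 1 ω) ω) ∂S.P =
        S.P {ω | S.T 1 ω = i} * ENNReal.ofReal (val p w α β N y) := fun i => by
    rcases Nat.eq_zero_or_pos i with rfl | hi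
    · have h0 : S.P {ω | S.T 1 ω = 0} = 0 := by
        have : ∀ᵐ ω ∂S.P, ¬ S.T 1 ω = 0 := by
          filter_upwards [S.ae_recurrent hp hs] with ω hω h0
          have := (hω.T_succ_mem 0).1
          rw [zero_add, h0] at this
          exact Nat.not_lt_zero _ this
        simpa [ae_iff] using this
      rw [h0, zero_mul, setLIntegral_measure_zero _ _ h0]
    · classical
      obtain ⟨Q, hQ, hT⟩ := S.exists_T_one_eq_iff hi
      let G : (ℕ → Bool) → ℝ := fun h => if Q h then 1 else 0
      have hind : ∀ f : S.Ω → ℝ, ∫ ω in {ω | S.T 1 ω = i}, f ω ∂S.P =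
          ∫ ω, G (S.hist i ω) * f ω ∂S.P := fun f => by
        rw [← integral_indicator (hms i)]
        refine integral_congr_ae (ae_of_all _ fun ω => ?_)
        simp only [Set.indicator_apply, Set.mem_ofPred_eq, hT, G]
        split_ifs <;> simp
      have hintegrable : Integrable (S.pathVal w α β N i) S.P := by
        simpa using S.integrable_mul_pathVal (fun _ => 1) w α β N i
      have h1 : ∫ ω in {ω | S.T 1 ω = i}, S.pathVal w α β N i ω ∂S.P =
          S.P.real {ω | S.T 1 ω = i} * val p w α β N y := by
        have h2 : S.P.real {ω | S.T 1 ω = i} * val p w α β N y =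
            ∫ ω in {ω | S.T 1 ω = i}, val p w α β N y ∂S.P := by simp
        rw [h2, hind, hind, S.integral_mul_pathVal hp]
        refine integral_congr_ae (ae_of_all _ fun ω => ?_)
        simp only [G]
        split_ifs with hq
        · rw [((hQ _ hq).agree hy).val_eq S.hv]
        · simp
      have h3 : ∫⁻ ω in {ω | S.T 1 ω = i}, ENNReal.ofReal (S.pathVal w α β N (S.T 1 ω) ω) ∂S.P =
          ∫⁻ ω in {ω | S.T 1 ω = i}, ENNReal.ofReal (S.pathVal w α β N i ω) ∂S.P :=
        setLIntegral_congr_fun (hms i) fun ω hω => by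
          rw [show S.T 1 ω = i from hω]
      rw [h3, ← ofReal_integral_eq_lintegral_ofReal hintegrable.integrableOn
        (ae_of_all _ (S.pathVal_nonneg hw hα hβ N i)), h1,
        ENNReal.ofReal_mul measureReal_nonneg, ofReal_measureReal]
  have hone : ∑' i, S.P {ω | S.T 1 ω = i} = 1 := by
    have := hsplit fun _ => 1
    simpa using this.symm
  rw [hsplit]
  simp only [hfib]
  rw [ENNReal.tsum_mul_right, hone, one_mul]

variable {S}

lemma Recurrent.tau_two {ω : S.Ω} (h : S.Recurrent ω) :
    S.T 1 ω + S.tau 2 ω = S.T 2 ω ∧ 1 ≤ S.tau 2 ω := by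
  have h1 : S.T 1 ω < S.T 2 ω := (h.T_succ_mem 1).1
  have h2 : S.tau 2 ω = S.T 2 ω - S.T 1 ω := rfl
  omega

lemma pathVal_wt_le {l m : ℝ} {N n t : ℕ} {ω : S.Ω} (hnt : n < t) (ht : S.hitY0 ω t)
    (hno : ∀ j, n < j → j < t → ¬ S.hitY0 ω j) :
    S.pathVal (fun _ => wt l m) 1 0 N n ω ≤
      Real.exp (l * (t - n : ℕ) + m * (∑ j ∈ Finset.Ioc n t, (S.X j ω).toNat : ℕ)) := by
  induction N generalizing n with
  | zero => exact (Real.exp_pos _).le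
  | succ N ih =>
    rw [pathVal]
    rcases Nat.eq_or_lt_of_le (Nat.succ_le_of_lt hnt) with rfl | hlt
    · rw [if_pos ((S.hitY0_iff _ _).1 ht), Nat.Ioc_succ_singleton]
      simp [wt]
    · rw [if_neg fun hh => hno _ (Nat.lt_succ_self n) hlt ((S.hitY0_iff _ _).2 hh)]
      refine (mul_le_mul_of_nonneg_left (ih hlt fun j h1 h2 => hno j (by omega) h2)
        (wt_nonneg l m _)).trans_eq ?_
      rw [← Finset.sum_Ioc_consecutive _ (Nat.le_succ n) hlt.le, Nat.succ_eq_add_one,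
        Nat.Ioc_succ_singleton, Finset.sum_singleton, wt, ← Real.exp_add,
        show t - n = t - (n + 1) + 1 by omega]
      congr 1
      push_cast
      ring

variable (S)

lemma val_wt_le_psi (hp : ∀ h, 0 ≤ prob p h) {C κ : ℝ} (hs : SurvivalBound p C κ) (l m : ℝ)
    (N : ℕ) {y : ℕ → Bool} (hy : IsHit v y) :
    ENNReal.ofReal (val p (fun _ => wt l m) 1 0 N y) ≤ S.psi l m := by
  rw [← S.lintegral_pathVal_T_one hp hs (fun _ => wt_nonneg l m) zero_le_one le_rfl N hy, psi]
  refine lintegral_mono_ae ?_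
  filter_upwards [S.ae_recurrent hp hs] with ω hω
  have h2 := hω.T_succ_mem 1
  exact ENNReal.ofReal_le_ofReal
    (pathVal_wt_le h2.1 h2.2 fun j h1 h2 => not_hit_of_lt_T_succ h1 h2)

lemma measure_lt_tau_le (hp : ∀ h, 0 ≤ prob p h) {C κ : ℝ} (hs : SurvivalBound p C κ) (N : ℕ) :
    S.P {ω | N < S.tau 2 ω} ≤ ENNReal.ofReal (C * Real.exp (-4 * κ * N)) := by
  have hy : IsHit v (push true fun _ => false) := ⟨rfl, fun i _ hi => by
    obtain ⟨i, rfl⟩ := Nat.exists_eq_succ_of_ne_zero hi.ne'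
    rfl⟩
  refine le_trans ?_ (ENNReal.ofReal_le_ofReal (hs.2.2 N (push true fun _ => false)))
  rw [survival, ← S.lintegral_pathVal_T_one hp hs (fun _ _ => zero_le_one) le_rfl zero_le_one N hy,
    ← lintegral_indicator_one (measurableSet_lt measurable_const (S.measurable_tau 2))]
  refine lintegral_mono_ae ?_
  filter_upwards [S.ae_recurrent hp hs] with ω hω
  refine Set.indicator_apply_le' (fun hmem => ?_) fun _ => zero_le
  have h2 := hω.tau_two
  have hmem : N < S.tau 2 ω := hmem
  rw [S.pathVal_eq_one fun j h3 h4 => not_hit_of_lt_T_succ (k := 1) h3 (by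
    change j < S.T 2 ω; omega)]
  simp

lemma integrable_tau (hp : ∀ h, 0 ≤ prob p h) {C κ : ℝ} (hs : SurvivalBound p C κ) :
    Integrable (fun ω => (S.tau 2 ω : ℝ)) S.P := by
  have hmeas : Measurable fun ω => (S.tau 2 ω : ℝ) :=
    (Measurable.of_discrete (f := fun n : ℕ => (n : ℝ))).comp (S.measurable_tau 2)
  refine ⟨hmeas.aestronglyMeasurable, ?_⟩
  rw [hasFiniteIntegral_iff_ofReal (ae_of_all _ fun ω => Nat.cast_nonneg _)]
  have h1 : ∀ ω, ENNReal.ofReal (S.tau 2 ω : ℝ) =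
      ∑' N : ℕ, {ω | N < S.tau 2 ω}.indicator (fun _ => (1 : ENNReal)) ω := fun ω => by
    rw [tsum_eq_sum (s := Finset.range (S.tau 2 ω))]
    · have h2 : ∀ N ∈ Finset.range (S.tau 2 ω),
          {ω | N < S.tau 2 ω}.indicator (fun _ => (1 : ENNReal)) ω = 1 := fun N hN =>
        Set.indicator_of_mem (show ω ∈ {ω | N < S.tau 2 ω} from Finset.mem_range.1 hN) _
      rw [Finset.sum_congr rfl h2]
      simp
    · intro N hN
      have hω : ω ∉ {ω | N < S.tau 2 ω} := fun h => hN (Finset.mem_range.2 h)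
      exact Set.indicator_of_notMem hω _
  have hms : ∀ N : ℕ, MeasurableSet {ω | N < S.tau 2 ω} := fun N =>
    measurableSet_lt measurable_const (S.measurable_tau 2)
  simp only [h1]
  rw [lintegral_tsum fun N => (measurable_const.indicator (hms N)).aemeasurable]
  refine lt_of_le_of_lt (ENNReal.tsum_le_tsum fun N =>
    (lintegral_indicator_one (hms N)).trans_le (S.measure_lt_tau_le hp hs N)) ?_
  refine lt_top_iff_ne_top.2 (Summable.tsum_ofReal_ne_top (Summable.mul_left C ?_))
  have hlt : Real.exp (-4 * κ) < 1 := by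
    rw [Real.exp_lt_one_iff]; linarith [hs.2.1]
  refine (summable_geometric_of_lt_one (Real.exp_pos _).le hlt).congr fun N => ?_
  rw [← Real.exp_nat_mul, mul_comm]

/-- The weights selecting the word `0…01`. -/
def zerosOne (k : ℕ) (c : Bool) : ℝ := if c = decide (k = 0) then 1 else 0

lemma zerosOne_nonneg (k : ℕ) (c : Bool) : 0 ≤ zerosOne k c := by
  unfold zerosOne; split_ifs <;> simp

lemma le_val_zerosOne {δ1 δ2 : ℝ} (h2 : 0 < δ2) (h1 : δ1 < 1)
    (hp : ∀ h, δ2 ≤ prob p h ∧ prob p h ≤ δ1) (k : ℕ) {h : ℕ → Bool}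
    (hz : ∀ i < v - 1 - k, h i = false) :
    δ2 * (1 - δ1) ^ k ≤ val p zerosOne 1 0 (k + 1) h := by
  induction k generalizing h with
  | zero =>
    have hhit : IsHit v (push true h) := by
      refine ⟨rfl, fun i hi hi0 => ?_⟩
      obtain ⟨i, rfl⟩ := Nat.exists_eq_succ_of_ne_zero hi0.ne'
      exact hz i (by omega)
    simp [val, step, hhit, zerosOne, (hp h).1]
  | succ k ih =>
    have hnot : ¬ IsHit v (push false h) := by simp [IsHit]
    have hih := ih (h := push false h) fun i hi => by
      cases i with
      | zero => rfl
      | succ i => exact hz i (by omega)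
    rw [val]
    simp only [step, push_zero, if_neg hnot]
    simp only [zerosOne, Nat.succ_ne_zero, decide_false, Bool.true_eq_false, if_false, if_true,
      zero_mul, mul_zero, zero_add, one_mul]
    have h3 : 0 ≤ δ2 * (1 - δ1) ^ k := by
      have : 0 ≤ 1 - δ1 := by linarith
      positivity
    rw [pow_succ]
    nlinarith [(hp h).2]

lemma pathVal_zerosOne (k n : ℕ) (ω : S.Ω) :
    S.pathVal zerosOne 1 0 (k + 1) n ω = 0 ∨ (S.pathVal zerosOne 1 0 (k + 1) n ω = 1 ∧
      S.hitY0 ω (n + k + 1) ∧ S.X (n + k + 1) ω = true ∧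
      ∀ j, n < j → j ≤ n + k → S.X j ω = false) := by
  induction k generalizing n with
  | zero =>
    simp only [pathVal, zerosOne, hitY0_iff, add_zero]
    by_cases hX : S.X (n + 1) ω = true
    · by_cases hh : IsHit v (S.hist (n + 1) ω)
      · right
        refine ⟨by simp [hX, hh], hh, hX, fun j h1 h2 => by omega⟩
      · left; simp [hh]
    · left; simp [hX]
  | succ k ih =>
    rw [pathVal]
    by_cases hX : S.X (n + 1) ω = true
    · left; simp [hX, zerosOne]
    · have hX' : S.X (n + 1) ω = false := by simpa using hX
      have hnot : ¬ IsHit v (S.hist (n + 1) ω) := fun hh => by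
        have := hh.1
        rw [hist_succ_zero, hX'] at this
        exact Bool.false_ne_true this
      rw [if_neg hnot, hX', show zerosOne (k + 1) false = 1 by simp [zerosOne], one_mul]
      rcases ih (n + 1) with h0 | ⟨h1, h2, h3, h4⟩
      · exact Or.inl h0
      · rw [show n + 1 + k + 1 = n + (k + 1) + 1 by ring] at h2 h3
        refine Or.inr ⟨h1, h2, h3, fun j hj hj' => ?_⟩
        rcases Nat.eq_or_lt_of_le (Nat.succ_le_of_lt hj) with rfl | hlt
        · exact hX'
        · exact h4 j hlt (by omega)

/-- Cycles consisting of a block of zeros followed by a one have positive probability. -/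
lemma le_measureReal_zerosOne {δ1 δ2 : ℝ} (h2 : 0 < δ2) (h1 : δ1 < 1)
    (hp : ∀ h, δ2 ≤ prob p h ∧ prob p h ≤ δ1) {C κ : ℝ} (hs : SurvivalBound p C κ) (k : ℕ)
    (hk : v ≤ k + 1) :
    δ2 * (1 - δ1) ^ k ≤ S.P.real {ω | S.tau 2 ω = k + 1 ∧ S.zeta 2 ω = 1} := by
  have hp0 : ∀ h, 0 ≤ prob p h := fun h => h2.le.trans (hp h).1
  have hy : IsHit v (push true fun _ => false) := ⟨rfl, fun i _ hi => by
    obtain ⟨i, rfl⟩ := Nat.exists_eq_succ_of_ne_zero hi.ne'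
    rfl⟩
  have hms : MeasurableSet {ω | S.tau 2 ω = k + 1 ∧ S.zeta 2 ω = 1} :=
    (S.measurable_tau 2 (measurableSet_singleton (k + 1))).inter
      (S.measurable_zeta 2 (measurableSet_singleton 1))
  refine (le_val_zerosOne h2 h1 hp k (h := push true fun _ => false)
    fun i hi => by omega).trans ?_
  rw [measureReal_def, ← ENNReal.ofReal_le_iff_le_toReal (measure_ne_top _ _),
    ← S.lintegral_pathVal_T_one hp0 hs zerosOne_nonneg zero_le_one le_rfl _ hy,
    ← lintegral_indicator_one hms]
  refine lintegral_mono_ae ?_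
  filter_upwards [S.ae_recurrent hp0 hs] with ω hω
  rcases S.pathVal_zerosOne k (S.T 1 ω) ω with h0 | ⟨e1, e2, e3, e4⟩
  · rw [h0]; simp
  · have hT : S.T 2 ω = S.T 1 ω + k + 1 := by
      refine le_antisymm (Nat.sInf_le ⟨by change S.T 1 ω < _; omega, e2⟩) ?_
      by_contra! hc
      have hm := hω.T_succ_mem 1
      have hX := e4 _ hm.1 (by change S.T 2 ω ≤ _; omega)
      have hh := ((S.hitY0_iff _ _).1 hm.2).1
      obtain ⟨t, ht⟩ := Nat.exists_eq_succ_of_ne_zero (Nat.ne_zero_of_lt hm.1)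
      rw [ht] at hh hX
      rw [Nat.succ_eq_add_one, hist_succ_zero] at hh
      rw [Nat.succ_eq_add_one, hh] at hX
      exact Bool.false_ne_true hX.symm
    rw [e1, Set.indicator_of_mem]
    · simp
    · refine ⟨by change S.T 2 ω - S.T 1 ω = _; omega, ?_⟩
      change ∑ j ∈ Finset.Ioc (S.T 1 ω) (S.T 2 ω), (S.X j ω).toNat = 1
      rw [hT, Finset.sum_Ioc_succ_top (by omega),
        Finset.sum_eq_zero fun j hj => ?_, e3]
      · rfl
      · rw [e4 j (Finset.mem_Ioc.1 hj).1 (Finset.mem_Ioc.1 hj).2]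
        rfl

end Regeneration

section Deviation

lemma sq_div_four_le_exp_sub {u : ℝ} (hu : -2 ≤ u) : u ^ 2 / 4 ≤ Real.exp u - 1 - u := by
  have h1 : u / 2 + 1 ≤ Real.exp (u / 2) := Real.add_one_le_exp _
  have h2 : Real.exp u = Real.exp (u / 2) ^ 2 := by
    rw [← Real.exp_nat_mul]; congr 1; push_cast; ring
  nlinarith

variable (S : VLMC v p)

lemma integrable_zeta (hp : ∀ h, 0 ≤ prob p h) {C κ : ℝ} (hs : SurvivalBound p C κ) :
    Integrable (fun ω => (S.zeta 2 ω : ℝ)) S.P := by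
  have hmeas : Measurable fun ω => (S.zeta 2 ω : ℝ) :=
    (Measurable.of_discrete (f := fun n : ℕ => (n : ℝ))).comp (S.measurable_zeta 2)
  refine (S.integrable_tau hp hs).mono' hmeas.aestronglyMeasurable (ae_of_all _ fun ω => ?_)
  rw [Real.norm_of_nonneg (Nat.cast_nonneg _)]
  exact_mod_cast S.zeta_le_tau 2 ω

lemma one_le_integral_tau (hp : ∀ h, 0 ≤ prob p h) {C κ : ℝ} (hs : SurvivalBound p C κ) :
    1 ≤ ∫ ω, (S.tau 2 ω : ℝ) ∂S.P := by
  have h1 : ∫ _, (1 : ℝ) ∂S.P = 1 := by simp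
  rw [← h1]
  refine integral_mono_ae (integrable_const 1) (S.integrable_tau hp hs) ?_
  filter_upwards [S.ae_recurrent hp hs] with ω hω
  exact_mod_cast hω.tau_two.2

lemma psi_zero : S.psi 0 0 = 1 := by simp [psi]

/-- The set `{ψ ≤ 1}` is star-shaped with respect to the origin. -/
lemma psi_smul_le_one {l m s : ℝ} (h : S.psi l m ≤ 1) (h0 : 0 ≤ s) (h1 : s ≤ 1) :
    S.psi (s * l) (s * m) ≤ 1 := by
  have hpt : ∀ ω, ENNReal.ofReal (Real.exp (s * l * S.tau 2 ω + s * m * S.zeta 2 ω)) ≤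
      ENNReal.ofReal s * ENNReal.ofReal (Real.exp (l * S.tau 2 ω + m * S.zeta 2 ω)) +
        ENNReal.ofReal (1 - s) := fun ω => by
    rw [← ENNReal.ofReal_mul h0, ← ENNReal.ofReal_add (by positivity) (by linarith)]
    refine ENNReal.ofReal_le_ofReal ?_
    have := convexOn_exp.2 (Set.mem_univ (l * S.tau 2 ω + m * S.zeta 2 ω)) (Set.mem_univ 0)
      h0 (by linarith : 0 ≤ 1 - s) (by ring)
    simp only [smul_eq_mul, mul_zero, add_zero, Real.exp_zero, mul_one] at this
    refine le_trans (le_of_eq ?_) this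
    congr 1
    ring
  calc S.psi (s * l) (s * m)
      ≤ ∫⁻ ω, (ENNReal.ofReal s * ENNReal.ofReal (Real.exp (l * S.tau 2 ω + m * S.zeta 2 ω)) +
        ENNReal.ofReal (1 - s)) ∂S.P := lintegral_mono hpt
    _ = ENNReal.ofReal s * S.psi l m + ENNReal.ofReal (1 - s) := by
        rw [lintegral_add_right _ measurable_const, lintegral_const_mul' _ _ ENNReal.ofReal_ne_top,
          psi]
        simp
    _ ≤ ENNReal.ofReal s * 1 + ENNReal.ofReal (1 - s) := by gcongr
    _ = 1 := by
        rw [mul_one, ← ENNReal.ofReal_add h0 (by linarith)]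
        simp

/-- Quantitative strict convexity of `ψ` at the origin. -/
lemma drift_le (hp : ∀ h, 0 ≤ prob p h) {C κ : ℝ} (hs : SurvivalBound p C κ) {q : ℝ}
    (hq : ∀ k, k = v ∨ k = v + 1 → q ≤ S.P.real {ω | S.tau 2 ω = k ∧ S.zeta 2 ω = 1})
    {l m : ℝ} (hψ : S.psi l m ≤ 1) (hu1 : -2 ≤ l * v + m) (hu2 : -2 ≤ l * (v + 1) + m) :
    l * (∫ ω, (S.tau 2 ω : ℝ) ∂S.P) + m * (∫ ω, (S.zeta 2 ω : ℝ) ∂S.P) ≤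
      -(q * ((l * v + m) ^ 2 / 4 + (l * (v + 1) + m) ^ 2 / 4)) := by
  set u : S.Ω → ℝ := fun ω => l * S.tau 2 ω + m * S.zeta 2 ω with hu
  have hiτ := (S.integrable_tau hp hs).const_mul l
  have hiζ := (S.integrable_zeta hp hs).const_mul m
  have hiu : Integrable u S.P := hiτ.add hiζ
  have hme : AEStronglyMeasurable (fun ω => Real.exp (u ω)) S.P :=
    Real.continuous_exp.comp_aestronglyMeasurable hiu.1
  have h0 : 0 ≤ᵐ[S.P] fun ω => Real.exp (u ω) := ae_of_all _ fun ω => (Real.exp_pos _).le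
  have hie : Integrable (fun ω => Real.exp (u ω)) S.P := by
    refine ⟨hme, ?_⟩
    rw [hasFiniteIntegral_iff_ofReal h0]
    exact lt_of_le_of_lt hψ ENNReal.one_lt_top
  have hle : ∫ ω, Real.exp (u ω) ∂S.P ≤ 1 := by
    rw [integral_eq_lintegral_of_nonneg_ae h0 hme]
    exact ENNReal.toReal_le_of_le_ofReal zero_le_one (hψ.trans_eq ENNReal.ofReal_one.symm)
  let A : ℕ → Set S.Ω := fun k => {ω | S.tau 2 ω = k ∧ S.zeta 2 ω = 1}
  have hA : ∀ k, MeasurableSet (A k) := fun k =>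
    (S.measurable_tau 2 (measurableSet_singleton k)).inter
      (S.measurable_zeta 2 (measurableSet_singleton 1))
  set c1 := (l * v + m) ^ 2 / 4 with hc1
  set c2 := (l * (v + 1) + m) ^ 2 / 4 with hc2
  have hpt : ∀ ω, (A v).indicator (fun _ => c1) ω + (A (v + 1)).indicator (fun _ => c2) ω ≤
      Real.exp (u ω) - 1 - u ω := fun ω => by
    by_cases ha : ω ∈ A v
    · have hb : ω ∉ A (v + 1) := fun hb => by
        have := ha.1.symm.trans hb.1
        omega
      have huω : u ω = l * v + m := by simp [hu, ha.1, ha.2]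
      rw [Set.indicator_of_mem ha, Set.indicator_of_notMem hb, add_zero, huω]
      exact sq_div_four_le_exp_sub hu1
    · rw [Set.indicator_of_notMem ha, zero_add]
      by_cases hb : ω ∈ A (v + 1)
      · have huω : u ω = l * (v + 1) + m := by simp [hu, hb.1, hb.2]
        rw [Set.indicator_of_mem hb, huω]
        exact sq_div_four_le_exp_sub hu2
      · rw [Set.indicator_of_notMem hb]
        linarith [Real.add_one_le_exp (u ω)]
  have hi1 : Integrable ((A v).indicator fun _ => c1) S.P := (integrable_const c1).indicator (hA v)
  have hi2 : Integrable ((A (v + 1)).indicator fun _ => c2) S.P :=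
    (integrable_const c2).indicator (hA (v + 1))
  have hie1 : Integrable (fun ω => Real.exp (u ω) - 1) S.P := hie.sub (integrable_const 1)
  have hI := integral_mono (hi1.add hi2) (hie1.sub hiu) hpt
  simp only [Pi.add_apply, Pi.sub_apply] at hI
  rw [integral_add hi1 hi2, integral_sub hie1 hiu, integral_sub hie (integrable_const 1),
    integral_indicator_const _ (hA v), integral_indicator_const _ (hA (v + 1))] at hI
  have hue : ∫ ω, u ω ∂S.P =
      l * (∫ ω, (S.tau 2 ω : ℝ) ∂S.P) + m * (∫ ω, (S.zeta 2 ω : ℝ) ∂S.P) := by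
    rw [hu, integral_add hiτ hiζ, integral_const_mul, integral_const_mul]
  simp only [integral_const, probReal_univ, smul_eq_mul, mul_one] at hI
  have hq1 := mul_le_mul_of_nonneg_right (hq v (Or.inl rfl)) (by positivity : 0 ≤ c1)
  have hq2 := mul_le_mul_of_nonneg_right (hq (v + 1) (Or.inr rfl)) (by positivity : 0 ≤ c2)
  rw [← hue]
  linarith

/-- For `α` close to `a`, only a small neighbourhood of the origin contributes to `D(α)`. -/
lemma exists_local (hp : ∀ h, 0 ≤ prob p h) {C κ : ℝ} (hs : SurvivalBound p C κ) {q : ℝ}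
    (hq0 : 0 < q)
    (hq : ∀ k, k = v ∨ k = v + 1 → q ≤ S.P.real {ω | S.tau 2 ω = k ∧ S.zeta 2 ω = 1}) :
    ∃ Δ > 0, ∀ α, |α - S.a| ≤ Δ → ∀ l m, S.psi l m ≤ 1 →
      (|l| ≤ κ ∧ |m| ≤ κ) ∨ l + m * α ≤ 0 := by
  set ε : ℝ := min κ (1 / (v + 2)) with hε
  have hε0 : 0 < ε := lt_min hs.2.1 (by positivity)
  have hεv : ε * (v + 2) ≤ 1 := by
    have : ε ≤ 1 / (v + 2) := min_le_right _ _
    rwa [le_div_iff₀ (by positivity)] at this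
  set t := ∫ ω, (S.tau 2 ω : ℝ) ∂S.P with ht
  have ht1 : 1 ≤ t := S.one_le_integral_tau hp hs
  have ht0 : 0 < t := by linarith
  set c := q * (ε ^ 2 / (8 * (v + 1) ^ 2)) with hc
  have hc0 : 0 < c := by positivity
  -- points of `{ψ ≤ 1}` on the boundary of the square of half-side `ε`
  have key : ∀ α, |α - S.a| ≤ c / (t * ε) → ∀ l m, S.psi l m ≤ 1 → max |l| |m| = ε →
      l + m * α ≤ 0 := by
    intro α hα l m hψ hmax
    have hl : |l| ≤ ε := hmax ▸ le_max_left _ _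
    have hm : |m| ≤ ε := hmax ▸ le_max_right _ _
    have hl' := abs_le.1 hl
    have hm' := abs_le.1 hm
    have hv0 : (0 : ℝ) ≤ v := Nat.cast_nonneg v
    have hd := S.drift_le hp hs hq hψ (by nlinarith) (by nlinarith)
    set u1 := l * v + m with hu1
    set u2 := l * (v + 1) + m with hu2
    have hε2 : ε ≤ (v + 1) * (|u1| + |u2|) := by
      rw [← hmax]
      refine max_le ?_ ?_
      · have : l = u2 - u1 := by rw [hu1, hu2]; ring
        rw [this]
        have := abs_sub u2 u1
        nlinarith [abs_nonneg u1, abs_nonneg u2]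
      · have : m = (v + 1) * u1 - v * u2 := by rw [hu1, hu2]; ring
        rw [this]
        have := abs_sub ((v + 1) * u1) (v * u2)
        rw [abs_mul, abs_mul, abs_of_nonneg hv0, abs_of_nonneg (by linarith : (0 : ℝ) ≤ v + 1)] at this
        nlinarith [abs_nonneg u1, abs_nonneg u2]
    have hsq : ε ^ 2 / (8 * (v + 1) ^ 2) ≤ u1 ^ 2 / 4 + u2 ^ 2 / 4 := by
      rw [div_le_iff₀ (by positivity)]
      have h1 : ε ^ 2 ≤ ((v + 1) * (|u1| + |u2|)) ^ 2 := pow_le_pow_left₀ hε0.le hε2 2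
      have h2 : (|u1| + |u2|) ^ 2 ≤ 2 * (u1 ^ 2 + u2 ^ 2) := by
        nlinarith [sq_nonneg (|u1| - |u2|), sq_abs u1, sq_abs u2]
      have h3 := mul_le_mul_of_nonneg_left h2 (sq_nonneg ((v : ℝ) + 1))
      rw [mul_pow] at h1
      linarith
    have hd' : t * (l + m * S.a) ≤ -c := by
      have ha : t * S.a = ∫ ω, (S.zeta 2 ω : ℝ) ∂S.P := by
        rw [a, mul_div_cancel₀ _ ht0.ne']
      have := mul_le_mul_of_nonneg_left hsq hq0.le
      rw [← ha] at hd
      linarith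
    have h4 : m * (α - S.a) ≤ c / t := by
      refine (le_abs_self _).trans ?_
      rw [abs_mul]
      refine (mul_le_mul hm hα (abs_nonneg _) hε0.le).trans_eq ?_
      field_simp
    have h5 : t * (m * (α - S.a)) ≤ c := by
      rwa [le_div_iff₀ ht0, mul_comm] at h4
    by_contra! hpos
    nlinarith [mul_pos ht0 hpos]
  refine ⟨c / (t * ε), by positivity, fun α hα l m hψ => ?_⟩
  rcases le_or_gt (max |l| |m|) ε with hle | hgt
  · left
    have hεκ : ε ≤ κ := min_le_left _ _
    exact ⟨(le_max_left _ _).trans (hle.trans hεκ), (le_max_right _ _).trans (hle.trans hεκ)⟩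
  · right
    have hM : 0 < max |l| |m| := hε0.trans hgt
    have hs0 : 0 < ε / max |l| |m| := div_pos hε0 hM
    have := key α hα _ _ (S.psi_smul_le_one hψ hs0.le ((div_le_one hM).2 hgt.le)) (by
      rw [abs_mul, abs_mul, abs_of_pos hs0, ← mul_max_of_nonneg _ _ hs0.le,
        div_mul_cancel₀ _ hM.ne'])
    rw [mul_assoc, ← mul_add] at this
    exact nonpos_of_mul_nonpos_right this hs0

lemma mainConst_pos {C κ : ℝ} (hC : 0 < C) (hκ : 0 < κ) : 0 < mainConst C κ := by
  have h1 : 0 < momentBound C κ := lt_of_lt_of_le one_pos (le_max_left _ _)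
  have h2 : 0 < 1 - Real.exp (-κ) := sub_pos.2 (Real.exp_lt_one_iff.2 (neg_lt_zero.2 hκ))
  unfold mainConst
  positivity

/-- An upper bound which holds for every exponent of the feasible set passes to the supremum. -/
lemma le_exp_D (S : VLMC v p) {P K c α : ℝ} {n : ℕ} (hn : 1 ≤ n) (hP : 0 ≤ P) (hK : 0 < K)
    (h : ∀ l m : ℝ, S.psi l m ≤ 1 → P ≤ K * Real.exp (-n * (l + m * α) - c)) :
    P ≤ K * Real.exp (-n * S.D α - c) := by
  have hn0 : (0 : ℝ) < n := by exact_mod_cast hn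
  rcases hP.eq_or_lt with rfl | hP
  · positivity
  have hD : S.D α ≤ (Real.log (K / P) - c) / n := by
    refine csSup_le ⟨0, 0, 0, S.psi_zero.le, by simp⟩ ?_
    rintro _ ⟨l, m, hψ, rfl⟩
    rw [le_div_iff₀ hn0]
    have h1 := h l m hψ
    have h2 : Real.exp (n * (l + m * α) + c) ≤ K / P := by
      rw [le_div_iff₀ hP, mul_comm]
      calc P * Real.exp (n * (l + m * α) + c)
          ≤ K * Real.exp (-n * (l + m * α) - c) * Real.exp (n * (l + m * α) + c) := by gcongr
        _ = K := by rw [mul_assoc, ← Real.exp_add]; ring_nf; simp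
    have h3 := (Real.le_log_iff_exp_le (by positivity)).2 h2
    linarith
  rw [le_div_iff₀ hn0] at hD
  have h1 : Real.exp (n * S.D α + c) ≤ K / P :=
    (Real.le_log_iff_exp_le (by positivity)).1 (by linarith)
  calc P = P * Real.exp (n * S.D α + c) * Real.exp (-n * S.D α - c) := by
        rw [mul_assoc, ← Real.exp_add]; ring_nf; simp
    _ ≤ P * (K / P) * Real.exp (-n * S.D α - c) := by gcongr
    _ = _ := by field_simp

end Deviation

end VLMC

namespace VLMC

/-- Lemma 4.5: under condition [A] there are `Δ > 0`, `C̃ > 0`,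
`γ̃ > 0` such that for all `x ∈ ℕ ∪ {0}` and `n ≥ 1` with `α = x/n` satisfying
`|α - a| ≤ Δ`, `P(R(n) = x, τ_{ν(n)+1} ≥ ln² n) ≤ C̃ e^{-n D(α) - γ̃ ln² n}`. -/
theorem statement10 {v : ℕ} {p : ℕ → (Fin (v - 1) → Bool) → ℝ} (S : VLMC v p)
    (hA : ∃ δ1 δ2 : ℝ, S.CondA δ1 δ2) :
    ∃ Δ > (0 : ℝ), ∃ Ct > (0 : ℝ), ∃ γt > (0 : ℝ),
      ∀ (x n : ℕ), 1 ≤ n → |(x : ℝ) / n - S.a| ≤ Δ →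
        S.P {ω | S.R n ω = x ∧ (Real.log n) ^ 2 ≤ (S.tau (S.nu n ω + 1) ω : ℝ)} ≤
          ENNReal.ofReal (Ct *
            Real.exp (-(n : ℝ) * S.D ((x : ℝ) / n) - γt * (Real.log n) ^ 2)) := by
  obtain ⟨δ1, δ2, -, h2, h21, h1, hb⟩ := hA
  have hp : ∀ h, δ2 ≤ prob p h ∧ prob p h ≤ δ1 := fun h => hb _ _
  have hp01 : ∀ h, 0 ≤ prob p h ∧ prob p h ≤ 1 := fun h =>
    ⟨h2.le.trans (hp h).1, (hp h).2.trans h1.le⟩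
  obtain ⟨C, hC, κ, hκ, hsurv⟩ := exists_survival_le S.hv h2 h1 hp
  have hs : SurvivalBound p C κ := ⟨hC, hκ, hsurv⟩
  have h1' : 0 < 1 - δ1 := sub_pos.2 h1
  have hq : ∀ k, k = v ∨ k = v + 1 →
      δ2 * (1 - δ1) ^ v ≤ S.P.real {ω | S.tau 2 ω = k ∧ S.zeta 2 ω = 1} := by
    rintro k (rfl | rfl)
    · have h := S.le_measureReal_zerosOne h2 h1 hp hs (k - 1) (by omega)
      rw [Nat.sub_add_cancel S.hv] at h
      refine le_trans ?_ h
      exact mul_le_mul_of_nonneg_left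
        (pow_le_pow_of_le_one h1'.le (by linarith) (Nat.sub_le _ _)) h2.le
    · exact S.le_measureReal_zerosOne h2 h1 hp hs v (by omega)
  obtain ⟨Δ, hΔ, hloc⟩ := S.exists_local (fun h => (hp01 h).1) hs (by positivity) hq
  refine ⟨Δ, hΔ, mainConst C κ, mainConst_pos hC hκ, κ, hκ, fun x n hn hα => ?_⟩
  have hn0 : (n : ℝ) ≠ 0 := by positivity
  rw [← ofReal_measureReal]
  refine ENNReal.ofReal_le_ofReal
    (S.le_exp_D hn measureReal_nonneg (mainConst_pos hC hκ) fun l m hψ => ?_)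
  have key : ∀ l m : ℝ, S.psi l m ≤ 1 → |l| ≤ κ → |m| ≤ κ →
      S.P.real {ω | S.R n ω = x ∧ (Real.log n) ^ 2 ≤ (S.tau (S.nu n ω + 1) ω : ℝ)} ≤
        mainConst C κ * Real.exp (-n * (l + m * (x / n)) - κ * (Real.log n) ^ 2) := by
    intro l m hψ hl hm
    refine (S.measureReal_long_cycle_le hp01 hs hl hm (fun N h hh => ?_) _ x n hn).trans_eq ?_
    · exact ENNReal.ofReal_le_one.1
        ((S.val_wt_le_psi (fun h => (hp01 h).1) hs l m N hh).trans hψ)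
    · congr 2
      field_simp
      ring
  rcases hloc _ hα l m hψ with ⟨hl, hm⟩ | hneg
  · exact key l m hψ hl hm
  · refine (key 0 0 S.psi_zero.le (by simpa using hκ.le) (by simpa using hκ.le)).trans ?_
    refine mul_le_mul_of_nonneg_left (Real.exp_le_exp.2 ?_) (mainConst_pos hC hκ).le
    have := mul_nonneg (Nat.cast_nonneg (α := ℝ) n) (neg_nonneg.2 hneg)
    linarith

end VLMC
end
end
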